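/- For every p ∈ (1,∞), the set A_p = {F ∈ SB : the Banach space F admits an equivalent p-AUS norm} is not Borel, i.e. A_p does not belong to the Effros–Borel σ-algebra of SB. -/

import Mathlib

open Metric Set Topology Filter

noncomputable def rhoN (X : Type*) [NormedAddCommGroup X] [NormedSpace ℝ X]
    (N : X → ℝ) (τ : ℝ) : ℝ :=
  letI := Classical.propDecidable (FiniteDimensional ℝ X)
  if FiniteDimensional ℝ X then 0
  else
    sSup { r : ℝ | ∃ y : X, N y ≤ 1 ∧
      r = sInf { s : ℝ | ∃ E : Submodule ℝ X, IsClosed (E : Set X) ∧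
            FiniteDimensional ℝ (X ⧸ E) ∧
            s = sSup { t : ℝ | ∃ x ∈ E, N x ≤ 1 ∧ t = N (y + τ • x) - 1 } } }

noncomputable def rho (X : Type*) [NormedAddCommGroup X] [NormedSpace ℝ X] (τ : ℝ) : ℝ :=
  rhoN X (fun x => ‖x‖) τ

def IsNormFn (X : Type*) [NormedAddCommGroup X] [NormedSpace ℝ X] (N : X → ℝ) : Prop :=
  (∀ x : X, 0 ≤ N x) ∧ (∀ x : X, N x = 0 ↔ x = 0) ∧
    (∀ (a : ℝ) (x : X), N (a • x) = |a| * N x) ∧ ∀ x y : X, N (x + y) ≤ N x + N y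

def IsEquivNorm (X : Type*) [NormedAddCommGroup X] [NormedSpace ℝ X] (N : X → ℝ) : Prop :=
  IsNormFn X N ∧ ∃ a > 0, ∃ b > 0, ∀ x : X, a * ‖x‖ ≤ N x ∧ N x ≤ b * ‖x‖

def IsPAUSNorm (X : Type*) [NormedAddCommGroup X] [NormedSpace ℝ X] (N : X → ℝ) (p : ℝ) : Prop :=
  ∃ C > 0, ∀ τ : ℝ, 0 ≤ τ → rhoN X N τ ≤ C * τ ^ p

def PAUSable (p : ℝ) (X : Type*) [NormedAddCommGroup X] [NormedSpace ℝ X] : Prop :=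
  ∃ N : X → ℝ, IsEquivNorm X N ∧ IsPAUSNorm X N p

def IsomToClosedSubspace (Y U : Type*) [NormedAddCommGroup Y] [NormedSpace ℝ Y]
    [NormedAddCommGroup U] [NormedSpace ℝ U] : Prop :=
  ∃ T : Y →L[ℝ] U, Function.Injective T ∧ ∃ c > 0, ∀ y : Y, c * ‖y‖ ≤ ‖T y‖

def IsQuotientOf (Y U : Type*) [NormedAddCommGroup Y] [NormedSpace ℝ Y]
    [NormedAddCommGroup U] [NormedSpace ℝ U] : Prop :=
  ∃ Q : U →L[ℝ] Y, Function.Surjective Q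


/-- The Cantor space `Δ = {0,1}^ℕ`. -/
abbrev CantorSpace : Type := ℕ → Bool

/-- The Banach space `C(Δ)` of continuous real functions on the Cantor space, with the
supremum norm. -/
abbrev CDelta : Type := C(CantorSpace, ℝ)

/-- The standard Borel space `SB` of all closed linear subspaces of `C(Δ)`. -/
def SB : Type := { F : Submodule ℝ CDelta // IsClosed ((F : Submodule ℝ CDelta) : Set CDelta) }

/-- The Effros–Borel σ-algebra on `SB`, generated by the sets `{F : F ∩ U ≠ ∅}` for `U` open. -/
instance : MeasurableSpace SB :=
  MeasurableSpace.generateFrom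
    { A : Set SB | ∃ U : Set CDelta, IsOpen U ∧
        A = { F : SB | (((F.1 : Submodule ℝ CDelta) : Set CDelta) ∩ U).Nonempty } }

namespace AUSComplexity

/-! ### The set of codes admitting an infinite branch is not Borel -/

/-- A code `T` has a branch if some infinite subset of `ℕ`, enumerated increasingly, has all its
nonempty finite initial segments in `T`. -/
def HasBranch (T : Finset ℕ → Bool) : Prop :=
  ∃ z : ℕ → ℕ, StrictMono z ∧ ∀ n, T ((Finset.range (n + 1)).image z) = true

/-- The strictly increasing sequence with prescribed gaps. -/
def stair (y : ℕ → ℕ) : ℕ → ℕ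
  | 0 => y 0
  | i + 1 => stair y i + y (i + 1) + 1

lemma stair_strictMono (y : ℕ → ℕ) : StrictMono (stair y) :=
  strictMono_nat_of_lt_succ fun i => by simp only [stair]; omega

lemma exists_stair_eq {z : ℕ → ℕ} (hz : StrictMono z) : ∃ y, stair y = z := by
  refine ⟨fun i => Nat.casesOn i (z 0) fun j => z (j + 1) - z j - 1, ?_⟩
  funext i
  induction i with
  | zero => rfl
  | succ i ih =>
    have := hz (Nat.lt_succ_self i)
    simp only [stair, ih]
    simp only [Nat.succ_eq_add_one] at this
    omega

lemma eq_of_stair_eq {y y' : ℕ → ℕ} {n : ℕ} (h : ∀ i < n, stair y i = stair y' i) :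
    ∀ i < n, y i = y' i := by
  intro i hi
  cases i with
  | zero => simpa [stair] using h 0 hi
  | succ i =>
    have h1 := h (i + 1) hi
    have h2 := h i (by omega)
    simp only [stair, h2] at h1
    omega

lemma eq_of_image_range_eq {z z' : ℕ → ℕ} (hz : StrictMono z) (hz' : StrictMono z') :
    ∀ n, (Finset.range n).image z = (Finset.range n).image z' → ∀ i < n, z i = z' i := by
  intro n
  induction n with
  | zero => intro _ i hi; omega
  | succ n ih =>
    intro h
    have key : ∀ {u v : ℕ → ℕ}, StrictMono u → StrictMono v →
        (Finset.range (n + 1)).image u = (Finset.range (n + 1)).image v → u n ≤ v n := by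
      intro u v _ hv huv
      have : u n ∈ (Finset.range (n + 1)).image v := by
        rw [← huv]; exact Finset.mem_image_of_mem _ (by simp)
      obtain ⟨j, hj, hj'⟩ := Finset.mem_image.1 this
      rw [← hj']
      exact hv.monotone (by simpa [Nat.lt_succ_iff] using hj)
    have hn : z n = z' n := le_antisymm (key hz hz' h) (key hz' hz h.symm)
    have herase : ∀ {u : ℕ → ℕ}, StrictMono u →
        ((Finset.range (n + 1)).image u).erase (u n) = (Finset.range n).image u := by
      intro u hu
      rw [Finset.range_add_one, Finset.image_insert, Finset.erase_insert]
      simp only [Finset.mem_image, Finset.mem_range, not_exists, not_and]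
      exact fun j hj hju => (hu hj).ne hju
    have h' := ih (by rw [← herase hz, ← herase hz', h, hn])
    intro i hi
    rcases Nat.lt_succ_iff_lt_or_eq.1 hi with hi | rfl
    · exact h' i hi
    · exact hn

/-- The finite set coding the first `n` bits of `c`. -/
def bits (c : ℕ → Bool) (n : ℕ) : Finset ℕ := (Finset.range n).filter fun j => c j = true

lemma eq_of_bits_eq {c c' : ℕ → Bool} {n : ℕ} (h : bits c n = bits c' n) :
    ∀ j < n, c j = c' j := by
  intro j hj
  have := Finset.ext_iff.1 h j
  simp only [bits, Finset.mem_filter, Finset.mem_range, hj, true_and] at this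
  exact Bool.eq_iff_iff.2 this

/-- The diagonal section of the closed set coded by `c`. -/
def diagCode (c : ℕ → Bool) (L : Finset ℕ) : Bool := c (Encodable.encode (L, bits c L.card))

lemma bits_congr {c c' : ℕ → Bool} {n : ℕ} (h : ∀ j < n, c j = c' j) : bits c n = bits c' n :=
  Finset.filter_congr fun j hj => by rw [h j (Finset.mem_range.1 hj)]

lemma eventually_nhds_forall_lt_eq (c : ℕ → Bool) (n : ℕ) : ∀ᶠ c' in 𝓝 c, ∀ j < n, c' j = c j := by
  have : ∀ᶠ c' in 𝓝 c, ∀ j ∈ Finset.range n, c' j = c j := by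
    rw [Filter.eventually_all_finset]
    intro j _
    exact ((continuous_apply j).tendsto c).eventually
      (p := fun b => b = c j) (by rw [nhds_discrete]; exact Filter.eventually_pure.2 rfl)
  simpa only [Finset.mem_range] using this

lemma measurable_diagCode : Measurable diagCode := by
  refine measurable_pi_lambda _ fun L => Continuous.measurable ?_
  rw [continuous_iff_continuousAt]
  intro c
  refine (tendsto_const_nhds (x := diagCode c L)).congr' ?_
  filter_upwards [eventually_nhds_forall_lt_eq c
    (max L.card (Encodable.encode (L, bits c L.card) + 1))] with c' hc'
  have : bits c' L.card = bits c L.card := bits_congr fun j hj => hc' j (by omega)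
  rw [diagCode, diagCode, this, hc' _ (by omega)]

/-- Diagonal argument: the set of codes with an infinite branch is not Borel. -/
theorem not_measurableSet_hasBranch : ¬ MeasurableSet {T | HasBranch T} := by
  intro h
  have hD : MeasurableSet {c | ¬ HasBranch (diagCode c)} := (measurable_diagCode h).compl
  have : PolishSpace Bool := inferInstance
  have hA := hD.analyticSet
  rw [MeasureTheory.AnalyticSet] at hA
  rcases hA with hA | ⟨g, hg, hgD⟩
  · have : (fun _ => false) ∈ {c | ¬ HasBranch (diagCode c)} := by
      rintro ⟨z, _, hz⟩
      simpa [diagCode] using hz 0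
    rw [hA] at this
    exact this
  · classical
    let P : Finset ℕ × Finset ℕ → Prop := fun x =>
      ∃ y, x.1 = (Finset.range x.1.card).image (stair y) ∧ x.2 = bits (g y) x.1.card
    let c : ℕ → Bool := fun m => decide (∃ x, Encodable.encode x = m ∧ P x)
    have hc : ∀ L, diagCode c L = true ↔ P (L, bits c L.card) := by
      intro L
      simp only [diagCode, c, decide_eq_true_eq]
      constructor
      · rintro ⟨x, hx, hPx⟩
        rwa [Encodable.encode_injective hx] at hPx
      · intro hP
        exact ⟨_, rfl, hP⟩
    have hcard : ∀ {z : ℕ → ℕ}, StrictMono z → ∀ n, ((Finset.range n).image z).card = n := by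
      intro z hz n
      rw [Finset.card_image_of_injective _ hz.injective, Finset.card_range]
    by_cases hcD : HasBranch (diagCode c)
    · obtain ⟨z, hz, hzT⟩ := hcD
      obtain ⟨y, rfl⟩ := exists_stair_eq hz
      have hP : ∀ n, ∃ y', (∀ i < n + 1, y' i = y i) ∧ ∀ j < n + 1, c j = g y' j := by
        intro n
        obtain ⟨y', h1, h2⟩ := (hc _).1 (hzT n)
        simp only [hcard hz] at h1 h2
        refine ⟨y', eq_of_stair_eq fun i hi => ?_, eq_of_bits_eq h2⟩
        exact (eq_of_image_range_eq hz (stair_strictMono y') _ h1 i hi).symm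
      choose y' hy1 hy2 using hP
      have hlim : Tendsto y' atTop (𝓝 y) := by
        rw [tendsto_pi_nhds]
        intro i
        refine (tendsto_const_nhds (x := y i)).congr' ?_
        filter_upwards [eventually_ge_atTop i] with n hn
        exact (hy1 n i (by omega)).symm
      have hgl := (hg.tendsto y).comp hlim
      have hcl : Tendsto (g ∘ y') atTop (𝓝 c) := by
        rw [tendsto_pi_nhds]
        intro i
        refine (tendsto_const_nhds (x := c i)).congr' ?_
        filter_upwards [eventually_ge_atTop i] with n hn
        exact hy2 n i (by omega)
      have hgy : g y = c := tendsto_nhds_unique hgl hcl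
      have : c ∈ {c | ¬ HasBranch (diagCode c)} := by rw [← hgD]; exact ⟨y, hgy⟩
      exact this ⟨stair y, hz, hzT⟩
    · have : c ∈ range g := by rw [hgD]; exact hcD
      obtain ⟨y, hy⟩ := this
      refine hcD ⟨stair y, stair_strictMono y, fun n => ?_⟩
      rw [hc]
      refine ⟨y, ?_, ?_⟩
      · simp only [hcard (stair_strictMono y)]
      · simp only [hy]

/-! ### Iterated admissible families -/

/-- A finite set is admissible for `T` if all its nonempty initial segments belong to `T`. -/
def Adm (T : Finset ℕ → Bool) (L : Finset ℕ) : Prop :=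
  ∀ l ∈ L, T (L.filter (· ≤ l)) = true

/-- The index of the interval containing `a` in the partition of `ℕ` determined by `L`. -/
def block (L : Finset ℕ) (a : ℕ) : ℕ := (L.filter (· ≤ a)).card

/-- Iterated families of finite sets: members of the `(n+1)`-st family are cut by an admissible
set into members of the `n`-th family. -/
def Fam (T : Finset ℕ → Bool) : ℕ → Set (Finset ℕ)
  | 0 => {A | A.card ≤ 1}
  | n + 1 => {A | ∃ L, Adm T L ∧ ∀ a ∈ A, A.filter (fun b => block L b = block L a) ∈ Fam T n}

lemma adm_empty (T : Finset ℕ → Bool) : Adm T ∅ := fun l hl => by simp at hl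

lemma mem_fam_of_subset {T : Finset ℕ → Bool} {n : ℕ} : ∀ {A B : Finset ℕ}, A ∈ Fam T n → B ⊆ A →
    B ∈ Fam T n := by
  induction n with
  | zero => exact fun hA hBA => (Finset.card_le_card hBA).trans hA
  | succ n ih =>
    rintro A B ⟨L, hL, hA⟩ hBA
    exact ⟨L, hL, fun a ha => ih (hA a (hBA ha)) (Finset.filter_subset_filter _ hBA)⟩

lemma empty_mem_fam (T : Finset ℕ → Bool) : ∀ n, ∅ ∈ Fam T n
  | 0 => by simp [Fam]
  | _ + 1 => ⟨∅, adm_empty T, fun a ha => by simp at ha⟩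

lemma mem_fam_succ {T : Finset ℕ → Bool} {n : ℕ} {A : Finset ℕ} (hA : A ∈ Fam T n) :
    A ∈ Fam T (n + 1) :=
  ⟨∅, adm_empty T, fun _ _ => mem_fam_of_subset hA (Finset.filter_subset _ _)⟩

lemma fam_mono (T : Finset ℕ → Bool) : Monotone (Fam T) :=
  monotone_nat_of_le_succ fun _ _ hA => mem_fam_succ hA

lemma singleton_mem_fam (T : Finset ℕ → Bool) (n k : ℕ) : {k} ∈ Fam T n :=
  fam_mono T (Nat.zero_le n) (by simp [Fam])

lemma isOpen_adm (L : Finset ℕ) : IsOpen {T | Adm T L} := by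
  have : {T | Adm T L} = ⋂ l ∈ L, {T : Finset ℕ → Bool | T (L.filter (· ≤ l)) = true} := by
    ext T; simp [Adm]
  rw [this]
  exact isOpen_biInter_finset fun l _ =>
    (isOpen_discrete {true}).preimage (continuous_apply (A := fun _ : Finset ℕ => Bool) _)

lemma isOpen_mem_fam (n : ℕ) : ∀ A, IsOpen {T | A ∈ Fam T n} := by
  induction n with
  | zero => intro A; exact isOpen_const
  | succ n ih =>
    intro A
    have : {T | A ∈ Fam T (n + 1)} = ⋃ L, {T | Adm T L} ∩
        ⋂ a ∈ A, {T | A.filter (fun b => block L b = block L a) ∈ Fam T n} := by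
      ext T; simp [Fam]
    rw [this]
    exact isOpen_iUnion fun L => (isOpen_adm L).inter (isOpen_biInter_finset fun a _ => ih _)

/-! ### The associated weights -/

/-- The supremum of the sums of `F` over members of the `n`-th family. -/
noncomputable def rhoLevel (T : Finset ℕ → Bool) (n : ℕ) (F : ℕ → ENNReal) : ENNReal :=
  ⨆ A : Fam T n, ∑ a ∈ A.1, F a

/-- The weighted sum of all levels. -/
noncomputable def rhoSum (T : Finset ℕ → Bool) (F : ℕ → ENNReal) : ENNReal :=
  ∑' n : ℕ, (2⁻¹ : ENNReal) ^ n * rhoLevel T n F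

variable {T : Finset ℕ → Bool} {n : ℕ} {F : ℕ → ENNReal}

lemma sum_le_rhoLevel {A : Finset ℕ} (hA : A ∈ Fam T n) (F : ℕ → ENNReal) :
    ∑ a ∈ A, F a ≤ rhoLevel T n F :=
  le_iSup (fun A : Fam T n => ∑ a ∈ A.1, F a) ⟨A, hA⟩

lemma rhoLevel_le {c : ENNReal} (h : ∀ A ∈ Fam T n, ∑ a ∈ A, F a ≤ c) : rhoLevel T n F ≤ c :=
  iSup_le fun A => h A.1 A.2

lemma rhoSum_const_mul (T : Finset ℕ → Bool) (c : ENNReal) (F : ℕ → ENNReal) :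
    rhoSum T (fun k => c * F k) = c * rhoSum T F := by
  simp only [rhoSum, rhoLevel, ← ENNReal.tsum_mul_left, ← Finset.mul_sum, ← ENNReal.mul_iSup]
  exact tsum_congr fun n => by ring

lemma rhoSum_zero (T : Finset ℕ → Bool) : rhoSum T 0 = 0 := by
  simp [rhoSum, rhoLevel]

lemma tsum_two_inv_pow : ∑' n : ℕ, (2⁻¹ : ENNReal) ^ n = 2 := by
  rw [ENNReal.tsum_geometric, ENNReal.one_sub_inv_two, inv_inv]

lemma rhoSum_le_two_mul_tsum (T : Finset ℕ → Bool) (F : ℕ → ENNReal) :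
    rhoSum T F ≤ 2 * ∑' k, F k := by
  rw [← tsum_two_inv_pow, ← ENNReal.tsum_mul_right]
  refine ENNReal.tsum_le_tsum fun n => ?_
  gcongr
  exact rhoLevel_le fun A _ => ENNReal.sum_le_tsum A

lemma le_rhoSum (T : Finset ℕ → Bool) (F : ℕ → ENNReal) (k : ℕ) : F k ≤ rhoSum T F := by
  calc F k = ∑ a ∈ {k}, F a := by simp
    _ ≤ rhoLevel T 0 F := sum_le_rhoLevel (singleton_mem_fam T 0 k) F
    _ = (2⁻¹ : ENNReal) ^ 0 * rhoLevel T 0 F := by simp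
    _ ≤ rhoSum T F := ENNReal.le_tsum (f := fun n => (2⁻¹ : ENNReal) ^ n * rhoLevel T n F) 0

/-- The restriction of `F` to the `i`-th class of the index function `β`. -/
def part (β : ℕ → ℕ) (i : ℕ) (F : ℕ → ENNReal) : ℕ → ENNReal := fun k => if β k = i then F k else 0

lemma tsum_part (β : ℕ → ℕ) (F : ℕ → ENNReal) (k : ℕ) : ∑' i, part β i F k = F k := by
  simp [part]

lemma rhoLevel_le_tsum_part (β : ℕ → ℕ) (F : ℕ → ENNReal) :
    rhoLevel T n F ≤ ∑' i, rhoLevel T n (part β i F) := by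
  refine rhoLevel_le fun A hA => ?_
  calc ∑ a ∈ A, F a = ∑ a ∈ A, ∑' i, part β i F a := by simp only [tsum_part]
    _ = ∑' i, ∑ a ∈ A, part β i F a :=
        (Summable.tsum_finsetSum fun _ _ => ENNReal.summable).symm
    _ ≤ _ := ENNReal.tsum_le_tsum fun i => sum_le_rhoLevel hA _

/-- The sum of the weights of the pieces of `F`. -/
noncomputable def blockSum (T : Finset ℕ → Bool) (β : ℕ → ℕ) (F : ℕ → ENNReal) : ENNReal :=
  ∑' i, rhoSum T (part β i F)

lemma blockSum_eq (T : Finset ℕ → Bool) (β : ℕ → ℕ) (F : ℕ → ENNReal) :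
    blockSum T β F = ∑' n : ℕ, (2⁻¹ : ENNReal) ^ n * ∑' i, rhoLevel T n (part β i F) := by
  simp only [blockSum, rhoSum, ← ENNReal.tsum_mul_left]
  exact ENNReal.tsum_comm

lemma rhoSum_le_blockSum (T : Finset ℕ → Bool) (β : ℕ → ℕ) (F : ℕ → ENNReal) :
    rhoSum T F ≤ blockSum T β F := by
  rw [blockSum_eq]
  refine ENNReal.tsum_le_tsum fun n => ?_
  gcongr
  exact rhoLevel_le_tsum_part β F

lemma blockSum_const_mul (T : Finset ℕ → Bool) (β : ℕ → ℕ) (c : ENNReal) (F : ℕ → ENNReal) :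
    blockSum T β (fun k => c * F k) = c * blockSum T β F := by
  simp only [blockSum, ← ENNReal.tsum_mul_left, ← rhoSum_const_mul]
  refine tsum_congr fun i => congrArg _ (funext fun k => ?_)
  simp only [part, mul_ite, mul_zero]

/-- The index function of the partition determined by an increasing sequence. -/
def seqBlock (z : ℕ → ℕ) (a : ℕ) : ℕ := ((Finset.range (a + 1)).filter (fun i => z i ≤ a)).card

lemma seqBlock_le_iff {z : ℕ → ℕ} (hz : StrictMono z) (a m : ℕ) : seqBlock z a ≤ m ↔ a < z m := by
  constructor
  · intro h
    by_contra! hc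
    have : Finset.range (m + 1) ⊆ (Finset.range (a + 1)).filter (fun i => z i ≤ a) := by
      intro i hi
      have hi' : i ≤ m := by simpa [Nat.lt_succ_iff] using hi
      have h1 := hz.monotone hi'
      have h2 := hz.le_apply (x := i)
      simp only [Finset.mem_filter, Finset.mem_range]
      omega
    have := Finset.card_le_card this
    rw [Finset.card_range] at this
    simp only [seqBlock] at h
    omega
  · intro h
    have : (Finset.range (a + 1)).filter (fun i => z i ≤ a) ⊆ Finset.range m := by
      intro i hi
      simp only [Finset.mem_filter, Finset.mem_range] at hi ⊢
      by_contra! hc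
      have := hz.monotone hc
      omega
    simpa [seqBlock] using Finset.card_le_card this

lemma block_image_eq {z : ℕ → ℕ} (hz : StrictMono z) {N a : ℕ} (ha : a < N) :
    block ((Finset.range N).image z) a = seqBlock z a := by
  rw [block, seqBlock, Finset.filter_image, Finset.card_image_of_injective _ hz.injective]
  congr 1
  ext i
  have h2 := hz.le_apply (x := i)
  simp only [Finset.mem_filter, Finset.mem_range]
  omega

lemma adm_image {z : ℕ → ℕ} (hz : StrictMono z)
    (hT : ∀ n, T ((Finset.range (n + 1)).image z) = true) (N : ℕ) :
    Adm T ((Finset.range N).image z) := by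
  intro l hl
  obtain ⟨i, hi, rfl⟩ := Finset.mem_image.1 hl
  convert hT i using 2
  ext l
  simp only [Finset.mem_filter, Finset.mem_image, Finset.mem_range] at hi ⊢
  constructor
  · rintro ⟨⟨j, _, rfl⟩, h⟩
    exact ⟨j, Nat.lt_succ_of_le (hz.le_iff_le.1 h), rfl⟩
  · rintro ⟨j, hj, rfl⟩
    exact ⟨⟨j, by omega, rfl⟩, hz.monotone (by omega)⟩

lemma tsum_rhoLevel_part_le {z : ℕ → ℕ} (hz : StrictMono z)
    (hT : ∀ n, T ((Finset.range (n + 1)).image z) = true) (F : ℕ → ENNReal) :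
    ∑' i, rhoLevel T n (part (seqBlock z) i F) ≤ rhoLevel T (n + 1) F := by
  rw [ENNReal.tsum_eq_iSup_sum]
  refine iSup_le fun s => ?_
  have : Nonempty (Fam T n) := ⟨⟨∅, empty_mem_fam T n⟩⟩
  have hsurj : ∀ i : ℕ, rhoLevel T n (part (seqBlock z) i F) =
      ⨆ c : ℕ → Fam T n, ∑ a ∈ (c i).1, part (seqBlock z) i F a := by
    intro i
    exact ((Function.surjective_eval (β := fun _ : ℕ => Fam T n) i).iSup_comp
      (fun A : Fam T n => ∑ a ∈ A.1, part (seqBlock z) i F a)).symm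
  simp only [hsurj]
  rw [ENNReal.finsetSum_iSup]
  · refine iSup_le fun c => ?_
    let A : Finset ℕ := s.biUnion fun i => (c i).1.filter fun a => seqBlock z a = i
    have hAi : ∀ a ∈ A, a ∈ (c (seqBlock z a)).1 := by
      intro a ha
      simp only [A, Finset.mem_biUnion, Finset.mem_filter] at ha
      obtain ⟨i, _, h, rfl⟩ := ha
      exact h
    have hA : A ∈ Fam T (n + 1) := by
      let N := A.sup id + 1
      have hN : ∀ a ∈ A, a < N := fun a ha => Nat.lt_succ_of_le (Finset.le_sup (f := id) ha)
      refine ⟨_, adm_image hz hT N, fun a ha =>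
        mem_fam_of_subset (c (seqBlock z a)).2 fun b hb => ?_⟩
      rw [Finset.mem_filter, block_image_eq hz (hN a ha)] at hb
      rw [block_image_eq hz (hN b hb.1)] at hb
      rw [← hb.2]
      exact hAi b hb.1
    refine le_trans (le_of_eq ?_) (sum_le_rhoLevel hA F)
    rw [Finset.sum_biUnion]
    · refine Finset.sum_congr rfl fun i _ => ?_
      rw [Finset.sum_filter]
      rfl
    · intro i _ j _ hij
      refine Finset.disjoint_left.2 fun a ha hb => hij ?_
      rw [← (Finset.mem_filter.1 ha).2, ← (Finset.mem_filter.1 hb).2]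
  · intro c c'
    classical
    refine ⟨fun i => if ∑ a ∈ (c i).1, part (seqBlock z) i F a ≤
      ∑ a ∈ (c' i).1, part (seqBlock z) i F a then c' i else c i, fun i => ?_⟩
    dsimp only
    split_ifs with h
    · exact ⟨h, le_rfl⟩
    · exact ⟨le_rfl, (not_le.1 h).le⟩

lemma blockSum_le_two_mul {z : ℕ → ℕ} (hz : StrictMono z)
    (hT : ∀ n, T ((Finset.range (n + 1)).image z) = true) (F : ℕ → ENNReal) :
    blockSum T (seqBlock z) F ≤ 2 * rhoSum T F := by
  have h2 : (2 : ENNReal) * 2⁻¹ = 1 := ENNReal.mul_inv_cancel (by simp) (by simp)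
  rw [blockSum_eq, rhoSum, ← ENNReal.tsum_mul_left]
  calc ∑' n : ℕ, (2⁻¹ : ENNReal) ^ n * ∑' i, rhoLevel T n (part (seqBlock z) i F)
      ≤ ∑' n : ℕ, 2 * ((2⁻¹ : ENNReal) ^ (n + 1) * rhoLevel T (n + 1) F) := by
        refine ENNReal.tsum_le_tsum fun n => ?_
        rw [pow_succ, show 2 * ((2⁻¹ : ENNReal) ^ n * 2⁻¹ * rhoLevel T (n + 1) F) =
          (2 * 2⁻¹) * ((2⁻¹ : ENNReal) ^ n * rhoLevel T (n + 1) F) by ring, h2, one_mul]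
        gcongr
        exact tsum_rhoLevel_part_le hz hT F
    _ ≤ _ := ENNReal.tsum_comp_le_tsum_of_injective (add_left_injective 1)
        (fun n : ℕ => 2 * ((2⁻¹ : ENNReal) ^ n * rhoLevel T n F))

lemma blockSum_cut {z : ℕ → ℕ} (hz : StrictMono z) (m : ℕ) (F : ℕ → ENNReal) :
    blockSum T (seqBlock z) (fun k => if k < z m then F k else 0) +
      blockSum T (seqBlock z) (fun k => if k < z m then 0 else F k) =
    blockSum T (seqBlock z) F := by
  rw [blockSum, blockSum, blockSum, ← ENNReal.tsum_add]
  refine tsum_congr fun i => ?_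
  by_cases hi : i ≤ m
  · have h1 : part (seqBlock z) i (fun k => if k < z m then F k else 0) =
        part (seqBlock z) i F := by
      funext k
      simp only [part]
      split_ifs with h h' <;> try rfl
      exact absurd ((seqBlock_le_iff hz k m).1 (h.trans_le hi)) h'
    have h2 : part (seqBlock z) i (fun k => if k < z m then 0 else F k) = 0 := by
      funext k
      simp only [part]
      split_ifs with h h' <;> try rfl
      exact absurd ((seqBlock_le_iff hz k m).1 (h.trans_le hi)) h'
    rw [h1, h2, rhoSum_zero, add_zero]
  · have h1 : part (seqBlock z) i (fun k => if k < z m then F k else 0) = 0 := by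
      funext k
      simp only [part]
      split_ifs with h h' <;> try rfl
      exact absurd (h ▸ (seqBlock_le_iff hz k m).2 h') hi
    have h2 : part (seqBlock z) i (fun k => if k < z m then 0 else F k) =
        part (seqBlock z) i F := by
      funext k
      simp only [part]
      split_ifs with h h' <;> try rfl
      exact absurd (h ▸ (seqBlock_le_iff hz k m).2 h') hi
    rw [h1, h2, rhoSum_zero, zero_add]

/-! ### Small convex combinations -/

/-- Convex sets of finitely supported probability vectors containing vectors supported arbitrarily
far away. -/
structure IsFar (S : Set (ℕ →₀ ℝ)) : Prop where
  convex : Convex ℝ S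
  nonneg : ∀ u ∈ S, ∀ k, 0 ≤ u k
  sum_eq_one : ∀ u ∈ S, ∑ k ∈ u.support, u k = 1
  exists_far : ∀ N, ∃ u ∈ S, ∀ k < N, u k = 0

/-- A family of finite sets is negligible if every far convex set contains vectors giving uniformly
small mass to its members. -/
def Negligible (X : Set (Finset ℕ)) : Prop :=
  ∀ S, IsFar S → ∀ ε : ℝ, 0 < ε → ∃ u ∈ S, ∀ A ∈ X, ∑ a ∈ A, u a ≤ ε

lemma IsFar.sum_le_one {S : Set (ℕ →₀ ℝ)} (hS : IsFar S) {u : ℕ →₀ ℝ} (hu : u ∈ S)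
    (A : Finset ℕ) : ∑ a ∈ A, u a ≤ 1 := by
  classical
  rw [← hS.sum_eq_one u hu]
  calc ∑ a ∈ A, u a ≤ ∑ a ∈ A ∪ u.support, u a :=
        Finset.sum_le_sum_of_subset_of_nonneg Finset.subset_union_left
          fun k _ _ => hS.nonneg u hu k
    _ = _ := by
        refine (Finset.sum_subset Finset.subset_union_right fun k _ hk => ?_).symm
        simpa using hk

lemma IsFar.sep {S : Set (ℕ →₀ ℝ)} (hS : IsFar S) {P : (ℕ →₀ ℝ) → Prop}
    (hP : Convex ℝ {u | P u}) (h : ∀ N, ∃ u ∈ S, P u ∧ ∀ k < N, u k = 0) :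
    IsFar {u ∈ S | P u} where
  convex := hS.convex.inter hP
  nonneg u hu := hS.nonneg u hu.1
  sum_eq_one u hu := hS.sum_eq_one u hu.1
  exists_far N := by
    obtain ⟨u, hu, hPu, h0⟩ := h N
    exact ⟨u, ⟨hu, hPu⟩, h0⟩

lemma convex_forall_lt_eq_zero (N : ℕ) : Convex ℝ {u : ℕ →₀ ℝ | ∀ k < N, u k = 0} := by
  intro u hu v hv a b _ _ _ k hk
  simp [hu k hk, hv k hk]

lemma convex_forall_sum_le (X : Set (Finset ℕ)) (ε : ℝ) :
    Convex ℝ {u : ℕ →₀ ℝ | ∀ A ∈ X, ∑ a ∈ A, u a ≤ ε} := by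
  intro u hu v hv a b ha hb hab A hA
  have h1 := mul_le_mul_of_nonneg_left (hu A hA) ha
  have h2 := mul_le_mul_of_nonneg_left (hv A hA) hb
  simp only [Finsupp.add_apply, Finsupp.smul_apply, smul_eq_mul, Finset.sum_add_distrib,
    ← Finset.mul_sum]
  calc _ ≤ a * ε + b * ε := add_le_add h1 h2
    _ = ε := by rw [← add_mul, hab, one_mul]

lemma IsFar.tail {S : Set (ℕ →₀ ℝ)} (hS : IsFar S) (N : ℕ) :
    IsFar {u ∈ S | ∀ k < N, u k = 0} :=
  hS.sep (convex_forall_lt_eq_zero N) fun M => by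
    obtain ⟨u, hu, h⟩ := hS.exists_far (max N M)
    exact ⟨u, hu, fun k hk => h k (by omega), fun k hk => h k (by omega)⟩

lemma Negligible.isFar {X : Set (Finset ℕ)} (hX : Negligible X) {S : Set (ℕ →₀ ℝ)}
    (hS : IsFar S) {ε : ℝ} (hε : 0 < ε) : IsFar {u ∈ S | ∀ A ∈ X, ∑ a ∈ A, u a ≤ ε} :=
  hS.sep (convex_forall_sum_le X ε) fun N => by
    obtain ⟨u, hu, h⟩ := hX _ (hS.tail N) ε hε
    exact ⟨u, hu.1, h, hu.2⟩

lemma Negligible.biUnion {X : ℕ → Set (Finset ℕ)} {s : Finset ℕ}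
    (h : ∀ i ∈ s, Negligible (X i)) : Negligible (⋃ i ∈ s, X i) := by
  classical
  induction s using Finset.induction_on with
  | empty =>
    intro S hS ε _
    obtain ⟨u, hu, _⟩ := hS.exists_far 0
    exact ⟨u, hu, by simp⟩
  | insert i s _ ih =>
    intro S hS ε hε
    obtain ⟨u, hu, hu'⟩ := ih (fun j hj => h j (Finset.mem_insert_of_mem hj)) _
      ((h i (Finset.mem_insert_self i s)).isFar hS hε) ε hε
    refine ⟨u, hu.1, fun A hA => ?_⟩
    rw [Finset.set_biUnion_insert] at hA
    exact hA.elim (hu.2 A) (hu' A)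

lemma exists_sum_le_of_step {X : Set (Finset ℕ)} {S₀ : Set (ℕ →₀ ℝ)} {ε : ℝ} (hε : 0 < ε)
    (hS₀ : IsFar S₀)
    (h : ∀ S ⊆ S₀, IsFar S → ∃ u ∈ S, ∃ S' ⊆ S, IsFar S' ∧
      ∀ A ∈ X, ∑ a ∈ A, u a ≤ ε ∨ ∀ v ∈ S', ∑ a ∈ A, v a ≤ ε) :
    ∃ u ∈ S₀, ∀ A ∈ X, ∑ a ∈ A, u a ≤ 2 * ε := by
  have key : ∀ m : ℕ, ∀ S ⊆ S₀, IsFar S →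
      ∃ u ∈ S, ∀ A ∈ X, m * ∑ a ∈ A, u a ≤ 1 + m * ε := by
    intro m
    induction m with
    | zero =>
      intro S _ hS
      obtain ⟨u, hu, _⟩ := hS.exists_far 0
      exact ⟨u, hu, by simp⟩
    | succ m ih =>
      intro S hSS hS
      obtain ⟨u, hu, S', hS'S, hS', hA⟩ := h S hSS hS
      obtain ⟨v, hv, hvA⟩ := ih S' (hS'S.trans hSS) hS'
      have hm : (0 : ℝ) < m + 1 := by positivity
      refine ⟨(1 / (m + 1) : ℝ) • u + (m / (m + 1) : ℝ) • v,
        hS.convex hu (hS'S hv) (by positivity) (by positivity) (by field_simp; ring),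
        fun A hAX => ?_⟩
      have hsum : ((m + 1 : ℕ) : ℝ) *
          ∑ a ∈ A, ((1 / (m + 1) : ℝ) • u + (m / (m + 1) : ℝ) • v : ℕ →₀ ℝ) a =
          ∑ a ∈ A, u a + m * ∑ a ∈ A, v a := by
        simp only [Finsupp.add_apply, Finsupp.smul_apply, smul_eq_mul, Finset.sum_add_distrib,
          ← Finset.mul_sum]
        push_cast
        field_simp
      rw [hsum]
      push_cast
      have hm0 : (0 : ℝ) ≤ m := m.cast_nonneg
      rcases hA A hAX with h1 | h1
      · linarith [hvA A hAX]
      · have := mul_le_mul_of_nonneg_left (h1 v hv) hm0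
        linarith [hS.sum_le_one hu A]
  obtain ⟨m, hm⟩ := exists_nat_gt (1 / ε)
  have hm0 : (0 : ℝ) < m := lt_trans (by positivity) hm
  obtain ⟨u, hu, hA⟩ := key m S₀ subset_rfl hS₀
  refine ⟨u, hu, fun A hAX => ?_⟩
  have h1 : 1 < m * ε := by rwa [div_lt_iff₀ hε] at hm
  have h2 := hA A hAX
  refine le_of_mul_le_mul_left ?_ hm0
  linarith

lemma negligible_fam_zero (T : Finset ℕ → Bool) : Negligible (Fam T 0) := by
  intro S₀ hS₀ ε hε
  have := exists_sum_le_of_step (X := Fam T 0) (half_pos hε) hS₀ fun S _ hS => by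
    obtain ⟨u, hu, _⟩ := hS.exists_far 0
    refine ⟨u, hu, _, fun v hv => hv.1, hS.tail (u.support.sup id + 1), fun A hA => ?_⟩
    rcases Finset.card_le_one_iff_subset_singleton.1 hA with ⟨k, hk⟩
    rcases Finset.subset_singleton_iff.1 hk with rfl | rfl
    · left; simpa using (half_pos hε).le
    · by_cases hku : u k = 0
      · left; simpa [hku] using (half_pos hε).le
      · right
        intro v hv
        have : k ≤ u.support.sup id := Finset.le_sup (f := id) (Finsupp.mem_support_iff.2 hku)
        simpa [hv.2 k (by omega)] using (half_pos hε).le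
  obtain ⟨u, hu, h⟩ := this
  exact ⟨u, hu, fun A hA => (h A hA).trans (by linarith)⟩

/-- The sets cut into members of `X` by some admissible end-extension of `M`. -/
def CutFam (T : Finset ℕ → Bool) (X : Set (Finset ℕ)) (M : Finset ℕ) : Set (Finset ℕ) :=
  {A | ∃ L, Adm T L ∧ M ⊆ L ∧ (∀ l ∈ L, l ∉ M → ∀ m ∈ M, m < l) ∧
    ∀ a ∈ A, A.filter (fun b => block L b = block L a) ∈ X}

lemma negligible_cutFam {X : Set (Finset ℕ)} (hX : Negligible X) {M : Finset ℕ}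
    (h : ∀ l, (∀ m ∈ M, m < l) → Adm T (insert l M) → Negligible (CutFam T X (insert l M))) :
    Negligible (CutFam T X M) := by
  classical
  intro S₁ hS₁ ε hε
  have hε' := half_pos hε
  have hS₀ := (hX.isFar hS₁ hε').tail (M.sup id)
  obtain ⟨u, hu, hA⟩ := exists_sum_le_of_step (X := CutFam T X M) hε' hS₀ fun S hSS hS => by
    obtain ⟨u, hu, _⟩ := hS.exists_far 0
    let N := u.support.sup id + 1
    have hN : ∀ k, u k ≠ 0 → k < N := fun k hk =>
      Nat.lt_succ_of_le (Finset.le_sup (f := id) (Finsupp.mem_support_iff.2 hk))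
    let s := (Finset.range N).filter fun l => (∀ m ∈ M, m < l) ∧ Adm T (insert l M)
    have hs : Negligible (⋃ l ∈ s, CutFam T X (insert l M)) :=
      Negligible.biUnion fun l hl => h l (Finset.mem_filter.1 hl).2.1 (Finset.mem_filter.1 hl).2.2
    refine ⟨u, hu, _, fun v hv => hv.1, hs.isFar hS hε', ?_⟩
    rintro A ⟨L, hL, hML, hext, hA⟩
    by_cases hl : ∃ l ∈ L \ M, l < N
    · right
      obtain ⟨l, hl, hlN⟩ := hl
      let l₀ := (L \ M).min' ⟨l, hl⟩
      have hl₀ := Finset.mem_sdiff.1 ((L \ M).min'_mem ⟨l, hl⟩)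
      have hmin : ∀ k ∈ L, k ∉ M → l₀ ≤ k := fun k hk hkM =>
        Finset.min'_le _ _ (Finset.mem_sdiff.2 ⟨hk, hkM⟩)
      have hMl₀ := hext l₀ hl₀.1 hl₀.2
      have hsub : insert l₀ M ⊆ L := Finset.insert_subset hl₀.1 hML
      have hext' : ∀ k ∈ L, k ∉ insert l₀ M → ∀ m ∈ insert l₀ M, m < k := by
        intro k hk hkM m hm
        rw [Finset.mem_insert, not_or] at hkM
        have := hmin k hk hkM.2
        rcases Finset.mem_insert.1 hm with rfl | hm
        · exact lt_of_le_of_ne this (Ne.symm hkM.1)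
        · exact hext k hk hkM.2 m hm
      have hadm : Adm T (insert l₀ M) := by
        intro k hk
        convert hL k (hsub hk) using 2
        ext j
        simp only [Finset.mem_filter]
        refine ⟨fun hj => ⟨hsub hj.1, hj.2⟩, fun hj => ⟨?_, hj.2⟩⟩
        by_contra hjM
        exact absurd hj.2 (not_le.2 (hext' j hj.1 hjM k hk))
      have hAs : A ∈ ⋃ l ∈ s, CutFam T X (insert l M) := by
        refine Set.mem_biUnion (x := l₀) ?_ ⟨L, hL, hsub, hext', hA⟩
        simp only [s, Finset.coe_filter, Set.mem_ofPred_eq, Finset.mem_range]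
        have hll := hmin l (Finset.mem_sdiff.1 hl).1 (Finset.mem_sdiff.1 hl).2
        exact ⟨lt_of_le_of_lt hll hlN, hMl₀, hadm⟩
      exact fun v hv => hv.2 A hAs
    · left
      push Not at hl
      have hblock : ∀ k, u k ≠ 0 → block L k = M.card := by
        intro k hk
        have hkM : M.sup id ≤ k := by
          by_contra! hc
          exact hk ((hSS hu).2 k hc)
        rw [block]
        congr 1
        ext l
        rw [Finset.mem_filter]
        constructor
        · rintro ⟨h1, h2⟩
          by_contra h3
          have := hl l (Finset.mem_sdiff.2 ⟨h1, h3⟩)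
          have := hN k hk
          omega
        · intro hlM
          exact ⟨hML hlM, (Finset.le_sup (f := id) hlM).trans hkM⟩
      by_cases h0 : ∃ a ∈ A, u a ≠ 0
      · obtain ⟨a, ha, hau⟩ := h0
        refine le_trans (le_of_eq ?_) ((hSS hu).1.2 _ (hA a ha))
        refine (Finset.sum_subset (Finset.filter_subset _ _) fun k hk hk' => ?_).symm
        by_contra hku
        exact hk' (Finset.mem_filter.2 ⟨hk, by rw [hblock k hku, hblock a hau]⟩)
      · push Not at h0
        rw [Finset.sum_eq_zero h0]
        exact hε'.le
  exact ⟨u, hu.1.1, fun A hAX => (hA A hAX).trans (by linarith)⟩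

lemma hasBranch_of_not_negligible {X : Set (Finset ℕ)} (hX : Negligible X)
    (h : ¬ Negligible (CutFam T X ∅)) : HasBranch T := by
  classical
  have step : ∀ M : {M // ¬ Negligible (CutFam T X M)}, ∃ l, (∀ m ∈ M.1, m < l) ∧
      Adm T (insert l M.1) ∧ ¬ Negligible (CutFam T X (insert l M.1)) := by
    intro M
    by_contra! hc
    exact M.2 (negligible_cutFam hX hc)
  choose next hlt hadm hneg using step
  let seq : ℕ → {M // ¬ Negligible (CutFam T X M)} := fun n =>
    Nat.rec ⟨∅, h⟩ (fun _ M => ⟨insert (next M) M.1, hneg M⟩) n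
  have hseq : ∀ n, (seq (n + 1)).1 = insert (next (seq n)) (seq n).1 := fun n => rfl
  have himage : ∀ n, (seq n).1 = (Finset.range n).image fun i => next (seq i) := by
    intro n
    induction n with
    | zero => rfl
    | succ n ih => rw [hseq, Finset.range_add_one, Finset.image_insert, ← ih]
  refine ⟨fun i => next (seq i), strictMono_nat_of_lt_succ fun n => hlt _ _ ?_, fun n => ?_⟩
  · rw [hseq]; exact Finset.mem_insert_self _ _
  · rw [← himage, hseq]
    have := hadm (seq n) _ (Finset.mem_insert_self _ _)
    convert this using 2
    refine (Finset.filter_true_of_mem fun m hm => ?_).symm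
    rcases Finset.mem_insert.1 hm with rfl | hm
    · exact le_rfl
    · exact (hlt _ m hm).le

lemma negligible_fam (hT : ¬ HasBranch T) (n : ℕ) : Negligible (Fam T n) := by
  induction n with
  | zero => exact negligible_fam_zero T
  | succ n ih =>
    have : Fam T (n + 1) = CutFam T (Fam T n) ∅ := by
      ext A; simp [Fam, CutFam]
    rw [this]
    by_contra hc
    exact hT (hasBranch_of_not_negligible ih hc)

lemma exists_rhoSum_le (hT : ¬ HasBranch T) {S : Set (ℕ →₀ ℝ)} (hS : IsFar S) {ε : ℝ}
    (hε : 0 < ε) : ∃ u ∈ S, rhoSum T (fun k => ENNReal.ofReal (u k)) ≤ ENNReal.ofReal ε := by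
  have htail : Tendsto (fun N => ∑' k, (2⁻¹ : ENNReal) ^ (k + N)) atTop (𝓝 0) :=
    ENNReal.tendsto_sum_nat_add _ (by rw [tsum_two_inv_pow]; simp)
  obtain ⟨N, hN⟩ := (htail.eventually (eventually_le_nhds
    (ENNReal.ofReal_pos.2 (half_pos hε)))).exists
  obtain ⟨u, hu, h⟩ := negligible_fam hT N S hS (ε / 4) (by positivity)
  have hofReal : ∀ A : Finset ℕ, ∑ a ∈ A, ENNReal.ofReal (u a) = ENNReal.ofReal (∑ a ∈ A, u a) :=
    fun A => (ENNReal.ofReal_sum_of_nonneg fun a _ => hS.nonneg u hu a).symm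
  refine ⟨u, hu, ?_⟩
  have h1 : ∀ n < N, rhoLevel T n (fun k => ENNReal.ofReal (u k)) ≤ ENNReal.ofReal (ε / 4) := by
    refine fun n hn => rhoLevel_le fun A hA => ?_
    rw [hofReal]
    exact ENNReal.ofReal_le_ofReal (h A (fam_mono T hn.le hA))
  have h2 : ∀ n, rhoLevel T n (fun k => ENNReal.ofReal (u k)) ≤ 1 := by
    refine fun n => rhoLevel_le fun A hA => ?_
    rw [hofReal, ← ENNReal.ofReal_one]
    exact ENNReal.ofReal_le_ofReal (hS.sum_le_one hu A)
  rw [rhoSum, ← Summable.sum_add_tsum_nat_add' (k := N) ENNReal.summable]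
  calc _ ≤ ∑ n ∈ Finset.range N, (2⁻¹ : ENNReal) ^ n * ENNReal.ofReal (ε / 4) +
        ∑' k, (2⁻¹ : ENNReal) ^ (k + N) := by
        gcongr with n hn k
        · exact h1 n (Finset.mem_range.1 hn)
        · exact mul_le_of_le_one_right' (h2 _)
    _ ≤ 2 * ENNReal.ofReal (ε / 4) + ENNReal.ofReal (ε / 2) := by
        rw [← Finset.sum_mul]
        gcongr
        exact (ENNReal.sum_le_tsum _).trans_eq tsum_two_inv_pow
    _ = ENNReal.ofReal ε := by
        rw [← ENNReal.ofReal_ofNat, ← ENNReal.ofReal_mul (by norm_num),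
          ← ENNReal.ofReal_add (by positivity) (by positivity)]
        congr 1; ring

/-! ### Retractions of the Cantor space onto closed subsets -/

/-- The initial segment of `x` of length `n` followed by `b` extends to a member of `C`. -/
def Extends (C : Set (ℕ → Bool)) (x : ℕ → Bool) (n : ℕ) (b : Bool) : Prop :=
  ∃ c ∈ C, (∀ i < n, c i = x i) ∧ c n = b

open Classical in
/-- Follow `δ` digit by digit, flipping a digit whenever this is needed to stay in `C`. -/
noncomputable def greedy (C : Set (ℕ → Bool)) (δ : ℕ → Bool) : ℕ → ℕ → Bool
  | 0 => fun _ => false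
  | n + 1 => Function.update (greedy C δ n) n
      (if Extends C (greedy C δ n) n (δ n) then δ n else !δ n)

/-- The limit of the greedy approximations. -/
noncomputable def retr (C : Set (ℕ → Bool)) (δ : ℕ → Bool) : ℕ → Bool :=
  fun n => greedy C δ (n + 1) n

variable {C : Set (ℕ → Bool)} {δ : ℕ → Bool}

lemma greedy_eq_retr {i n : ℕ} (h : i < n) : greedy C δ n i = retr C δ i := by
  induction n with
  | zero => omega
  | succ n ih =>
    rcases Nat.lt_succ_iff_lt_or_eq.1 h with h | rfl
    · rw [← ih h, greedy, Function.update_of_ne h.ne]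
    · rfl

lemma greedy_congr {δ' : ℕ → Bool} {n : ℕ} (h : ∀ j < n, δ' j = δ j) :
    greedy C δ' n = greedy C δ n := by
  induction n with
  | zero => rfl
  | succ n ih =>
    rw [greedy, greedy, ih fun j hj => h j (by omega), h n (by omega)]

lemma continuous_retr (C : Set (ℕ → Bool)) : Continuous (retr C) := by
  refine continuous_pi fun n => continuous_iff_continuousAt.2 fun δ => ?_
  have : ∀ᶠ δ' in 𝓝 δ, retr C δ' n = retr C δ n :=
    (eventually_nhds_forall_lt_eq δ (n + 1)).mono fun δ' h => congrFun (greedy_congr h) n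
  exact (continuousAt_congr this).2 continuousAt_const

lemma exists_mem_eq_greedy (hC : C.Nonempty) (δ : ℕ → Bool) (n : ℕ) :
    ∃ c ∈ C, ∀ i < n, c i = greedy C δ n i := by
  induction n with
  | zero => exact hC.imp fun c hc => ⟨hc, fun i hi => by omega⟩
  | succ n ih =>
    suffices h : ∃ c ∈ C, (∀ i < n, c i = greedy C δ n i) ∧ c n = greedy C δ (n + 1) n by
      obtain ⟨c, hc, h, hn⟩ := h
      refine ⟨c, hc, fun i hi => ?_⟩
      rcases Nat.lt_succ_iff_lt_or_eq.1 hi with hi | rfl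
      · rw [h i hi, greedy_eq_retr hi, greedy_eq_retr (hi.trans (Nat.lt_succ_self n))]
      · exact hn
    rw [greedy, Function.update_self]
    split_ifs with hE
    · exact hE
    · obtain ⟨c, hc, h⟩ := ih
      refine ⟨c, hc, h, ?_⟩
      have : c n ≠ δ n := fun hcn => hE ⟨c, hc, h, hcn⟩
      exact Bool.eq_not.2 this

lemma retr_mem (hC : C.Nonempty) (hcl : IsClosed C) (δ : ℕ → Bool) : retr C δ ∈ C := by
  choose c hc h using exists_mem_eq_greedy hC δ
  refine hcl.mem_of_tendsto (f := c) (b := atTop) ?_ (Eventually.of_forall hc)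
  refine tendsto_pi_nhds.2 fun i => tendsto_const_nhds.congr' ?_
  filter_upwards [eventually_gt_atTop i] with n hn
  rw [h n i hn, greedy_eq_retr hn]

lemma retr_eq_self (hδ : δ ∈ C) : retr C δ = δ := by
  have h : ∀ n, ∀ i < n, greedy C δ n i = δ i := by
    intro n
    induction n with
    | zero => intro i hi; omega
    | succ n ih =>
      intro i hi
      rw [greedy]
      rcases Nat.lt_succ_iff_lt_or_eq.1 hi with hi | rfl
      · rw [Function.update_of_ne hi.ne, ih i hi]
      · rw [Function.update_self, if_pos ⟨δ, hδ, fun j hj => (ih j hj).symm, rfl⟩]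
  exact funext fun n => h (n + 1) n (Nat.lt_succ_self n)

lemma isClosed_forall_lt {X : Type*} [TopologicalSpace X] {n : ℕ} {P : ℕ → X → Prop}
    (h : ∀ i < n, IsClosed {x | P i x}) : IsClosed {x | ∀ i < n, P i x} := by
  have : {x | ∀ i < n, P i x} = ⋂ i, ⋂ (_ : i < n), {x | P i x} := by ext; simp
  rw [this]
  exact isClosed_iInter fun i => isClosed_iInter fun hi => h i hi

lemma isClosed_extends {X : Type*} [TopologicalSpace X] {C : X → Set (ℕ → Bool)}
    (hC : IsClosed {q : X × (ℕ → Bool) | q.2 ∈ C q.1}) (n : ℕ) (b : Bool) :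
    IsClosed {q : X × (ℕ → Bool) | Extends (C q.1) q.2 n b} := by
  have hA : IsClosed {r : (X × (ℕ → Bool)) × (ℕ → Bool) |
      r.2 ∈ C r.1.1 ∧ (∀ i < n, r.2 i = r.1.2 i) ∧ r.2 n = b} := by
    refine (hC.preimage (by fun_prop : Continuous fun r : (X × (ℕ → Bool)) × (ℕ → Bool) =>
      (r.1.1, r.2))).inter (IsClosed.inter ?_ ?_)
    · exact isClosed_forall_lt fun i _ => isClosed_eq (by fun_prop) (by fun_prop)
    · exact isClosed_eq (by fun_prop) (by fun_prop)
  convert isClosedMap_fst_of_compactSpace _ hA using 1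
  ext q
  simp only [Extends, Set.mem_image, Set.mem_ofPred_eq, Prod.exists, exists_and_right,
    exists_eq_right]

lemma measurable_retr {X : Type*} [TopologicalSpace X] [SecondCountableTopology X]
    [MeasurableSpace X] [BorelSpace X] {C : X → Set (ℕ → Bool)}
    (hC : IsClosed {q : X × (ℕ → Bool) | q.2 ∈ C q.1}) (δ : ℕ → Bool) :
    Measurable fun x => retr (C x) δ := by
  have hg : ∀ n, Measurable fun x => greedy (C x) δ n := by
    intro n
    induction n with
    | zero => exact measurable_const
    | succ n ih =>
      have hE : MeasurableSet {x | Extends (C x) (greedy (C x) δ n) n (δ n)} :=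
        (measurable_id.prodMk ih) (isClosed_extends hC n (δ n)).measurableSet
      refine measurable_pi_lambda _ fun i => ?_
      by_cases hi : i = n
      · subst hi
        simp only [greedy, Function.update_self]
        exact Measurable.ite hE measurable_const measurable_const
      · simp only [greedy, Function.update_of_ne hi]
        exact (measurable_pi_apply i).comp ih
  exact measurable_pi_lambda _ fun n => (measurable_pi_apply n).comp (hg (n + 1))

/-! ### Measurability of closed spans -/

lemma measurableSet_norm_sub_le {X : Type*} [MeasurableSpace X] {g : X → CDelta}
    (hg : ∀ δ, Measurable fun x => g x δ) (h : CDelta) (r : ℝ) :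
    MeasurableSet {x | ‖g x - h‖ ≤ r} := by
  by_cases hr : 0 ≤ r
  · obtain ⟨D, hDc, hD⟩ := TopologicalSpace.exists_countable_dense CantorSpace
    have : {x | ‖g x - h‖ ≤ r} = ⋂ δ ∈ D, {x | ‖g x δ - h δ‖ ≤ r} := by
      ext x
      simp only [Set.mem_ofPred_eq, Set.mem_iInter]
      refine ⟨fun hx δ _ => (ContinuousMap.norm_le _ hr).1 hx δ, fun hx =>
        (ContinuousMap.norm_le _ hr).2 fun δ => ?_⟩
      have hcl : IsClosed {δ | ‖g x δ - h δ‖ ≤ r} := isClosed_le (by fun_prop) continuous_const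
      exact hD.induction hx hcl δ
    rw [this]
    exact MeasurableSet.biInter hDc fun δ _ =>
      measurableSet_le ((hg δ).sub_const _).norm measurable_const
  · have : {x | ‖g x - h‖ ≤ r} = ∅ := by
      ext x
      simp only [Set.mem_ofPred_eq, Set.mem_empty_iff_false, iff_false, not_le]
      exact (not_le.1 hr).trans_le (norm_nonneg _)
    rw [this]
    exact MeasurableSet.empty

lemma measurableSet_preimage_of_isOpen {X : Type*} [MeasurableSpace X] {g : X → CDelta}
    (hg : ∀ δ, Measurable fun x => g x δ) {U : Set CDelta} (hU : IsOpen U) :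
    MeasurableSet (g ⁻¹' U) := by
  have : ∀ h : U, ∃ r > 0, closedBall h.1 r ⊆ U := fun h =>
    Metric.nhds_basis_closedBall.mem_iff.1 (hU.mem_nhds h.2)
  choose r hr hrU using this
  obtain ⟨S, hS, hSU⟩ := TopologicalSpace.isOpen_iUnion_countable (fun h : U => ball h.1 (r h))
    fun h => isOpen_ball
  have hpre : g ⁻¹' U = ⋃ h ∈ S, {x | ‖g x - h.1‖ ≤ r h} := by
    ext x
    simp only [Set.mem_preimage, Set.mem_iUnion, Set.mem_ofPred_eq, exists_prop]
    constructor
    · intro hx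
      have : g x ∈ ⋃ h : U, ball h.1 (r h) := Set.mem_iUnion.2 ⟨⟨_, hx⟩, mem_ball_self (hr _)⟩
      rw [← hSU] at this
      simp only [Set.mem_iUnion, exists_prop] at this
      obtain ⟨h, hh, hx⟩ := this
      exact ⟨h, hh, by rw [← dist_eq_norm]; exact (mem_ball.1 hx).le⟩
    · rintro ⟨h, _, hx⟩
      exact hrU h (by rwa [mem_closedBall, dist_eq_norm])
  rw [hpre]
  exact MeasurableSet.biUnion hS fun h _ => measurableSet_norm_sub_le hg _ _

/-- The closed linear span of a sequence, as an element of `SB`. -/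
noncomputable def closedSpan (v : ℕ → CDelta) : SB :=
  ⟨(Submodule.span ℝ (Set.range v)).topologicalClosure,
    Submodule.isClosed_topologicalClosure _⟩

lemma closedSpan_inter_nonempty_iff (v : ℕ → CDelta) {U : Set CDelta} (hU : IsOpen U) :
    (((closedSpan v).1 : Set CDelta) ∩ U).Nonempty ↔
      ∃ a : ℕ →₀ ℚ, (a.sum fun k q => (q : ℝ) • v k) ∈ U := by
  let Q : Set CDelta := Set.range fun a : ℕ →₀ ℚ => a.sum fun k q => (q : ℝ) • v k
  have hadd : ∀ x ∈ Q, ∀ y ∈ Q, x + y ∈ Q := by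
    rintro _ ⟨a, rfl⟩ _ ⟨b, rfl⟩
    exact ⟨a + b, Finsupp.sum_add_index' (by simp) (by simp [add_smul])⟩
  have hsmul : ∀ q : ℚ, ∀ x ∈ Q, (q : ℝ) • x ∈ Q := by
    rintro q _ ⟨a, rfl⟩
    refine ⟨q • a, ?_⟩
    simp only
    rw [Finsupp.sum_smul_index (by simp), Finsupp.smul_sum]
    simp [mul_smul]
  have hspan : ∀ x ∈ Submodule.span ℝ (Set.range v), x ∈ closure Q := by
    intro x hx
    induction hx using Submodule.span_induction with
    | mem x hx =>
      obtain ⟨k, rfl⟩ := hx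
      exact subset_closure ⟨Finsupp.single k 1, by simp⟩
    | zero => exact subset_closure ⟨0, by simp⟩
    | add x y _ _ hx hy => exact map_mem_closure₂ continuous_add hx hy hadd
    | smul r x _ hx =>
      refine map_mem_closure₂ continuous_smul (Rat.denseRange_cast (𝕜 := ℝ) r) hx ?_
      rintro _ ⟨q, rfl⟩ x hx
      exact hsmul q x hx
  constructor
  · rintro ⟨x, hx, hxU⟩
    have hx' : x ∈ closure Q := closure_minimal hspan isClosed_closure hx
    obtain ⟨_, hy, a, rfl⟩ := mem_closure_iff.1 hx' U hU hxU
    exact ⟨a, hy⟩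
  · rintro ⟨a, ha⟩
    refine ⟨_, Submodule.le_topologicalClosure _ ?_, ha⟩
    exact Submodule.sum_mem _ fun k _ =>
      Submodule.smul_mem _ _ (Submodule.subset_span (Set.mem_range_self k))

lemma measurable_closedSpan {X : Type*} [MeasurableSpace X] {v : X → ℕ → CDelta}
    (hv : ∀ k δ, Measurable fun x => v x k δ) : Measurable fun x => closedSpan (v x) := by
  refine measurable_generateFrom ?_
  rintro _ ⟨U, hU, rfl⟩
  have : (fun x => closedSpan (v x)) ⁻¹' {F : SB | ((F.1 : Set CDelta) ∩ U).Nonempty} =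
      ⋃ a : ℕ →₀ ℚ, (fun x => a.sum fun k q => (q : ℝ) • v x k) ⁻¹' U := by
    ext x
    simp only [Set.mem_preimage, Set.mem_ofPred_eq, Set.mem_iUnion]
    exact closedSpan_inter_nonempty_iff (v x) hU
  rw [this]
  refine MeasurableSet.iUnion fun a => measurableSet_preimage_of_isOpen (fun δ => ?_) hU
  simp only [Finsupp.sum, ContinuousMap.sum_apply, ContinuousMap.smul_apply]
  exact Finset.measurable_sum _ fun k _ => (hv k δ).const_smul (a k : ℝ)

/-! ### The spaces attached to trees -/

lemma lowerSemicontinuous_rhoSum {X : Type*} [TopologicalSpace X] {T : X → Finset ℕ → Bool}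
    (hT : Continuous T) {F : X → ℕ → ENNReal} (hF : ∀ k, Continuous fun x => F x k) :
    LowerSemicontinuous fun x => rhoSum (T x) (F x) := by
  refine lowerSemicontinuous_tsum fun n => ?_
  refine Continuous.comp_lowerSemicontinuous (g := fun y : ENNReal => (2⁻¹ : ENNReal) ^ n * y)
    (ENNReal.continuous_const_mul (by simp)) ?_ fun a b h => by dsimp only; gcongr
  simp only [rhoLevel, iSup_subtype]
  refine lowerSemicontinuous_iSup fun A x y hy => ?_
  obtain ⟨hA, hy⟩ := lt_iSup_iff.1 hy
  have hcont : Continuous fun x => ∑ a ∈ A, F x a := continuous_finsetSum _ fun a _ => hF a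
  filter_upwards [((isOpen_mem_fam n A).preimage hT).mem_nhds hA,
    hcont.continuousAt.eventually_const_lt hy] with x' h1 h2
  exact h2.trans_le (le_iSup (fun _ : A ∈ Fam (T x') n => ∑ a ∈ A, F x' a) h1)

/-- A continuous surjection of the Cantor space onto the cube `[-1, 1]^ℕ`. -/
noncomputable def cubePoint (c : ℕ → Bool) (k : ℕ) : ℝ := 2 * (cantorToHilbert c k : ℝ) - 1

lemma continuous_cubePoint (k : ℕ) : Continuous fun c => cubePoint c k := by
  have := (continuous_apply (A := fun _ : ℕ => unitInterval) k).comp cantorToHilbert_continuous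
  exact (continuous_const.mul (continuous_subtype_val.comp this)).sub continuous_const

lemma exists_cubePoint_eq {f : ℕ → ℝ} (hf : ∀ k, |f k| ≤ 1) : ∃ c, cubePoint c = f := by
  obtain ⟨c, hc⟩ := cantorToHilbert_surjective fun k => (⟨(f k + 1) / 2, by
    have := abs_le.1 (hf k); constructor <;> linarith⟩ : unitInterval)
  refine ⟨c, funext fun k => ?_⟩
  rw [cubePoint, hc]
  dsimp only
  ring

/-- The codes of the points of the cube whose `q`-th powers have weight at most one. -/
def codes (q : ℝ) (T : Finset ℕ → Bool) : Set (ℕ → Bool) :=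
  {c | rhoSum T (fun k => ‖cubePoint c k‖ₑ ^ q) ≤ 1}

lemma isClosed_codes (q : ℝ) :
    IsClosed {r : (Finset ℕ → Bool) × (ℕ → Bool) | r.2 ∈ codes q r.1} := by
  refine (lowerSemicontinuous_rhoSum continuous_fst (F := fun r k => ‖cubePoint r.2 k‖ₑ ^ q)
    fun k => ?_).isClosed_preimage 1
  exact ENNReal.continuous_rpow_const.comp ((continuous_cubePoint k).comp continuous_snd).enorm

lemma isClosed_codes_right (q : ℝ) (T : Finset ℕ → Bool) : IsClosed (codes q T) :=
  (isClosed_codes q).preimage (by fun_prop : Continuous fun c : ℕ → Bool => (T, c))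

/-- A continuous surjection of the Cantor space onto the points of weight at most one. -/
noncomputable def point (q : ℝ) (T : Finset ℕ → Bool) (δ : CantorSpace) : ℕ → ℝ :=
  cubePoint (retr (codes q T) δ)

/-- The coordinates of `point`. -/
noncomputable def coordFn (q : ℝ) (T : Finset ℕ → Bool) (k : ℕ) : CDelta :=
  ⟨fun δ => point q T δ k, (continuous_cubePoint k).comp (continuous_retr _)⟩

@[simp] lemma coordFn_apply (q : ℝ) (T : Finset ℕ → Bool) (k : ℕ) (δ : CantorSpace) :
    coordFn q T k δ = point q T δ k := rfl

lemma exists_point_eq {q : ℝ} (hq : 0 < q) {T : Finset ℕ → Bool} {f : ℕ → ℝ}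
    (hf : rhoSum T (fun k => ‖f k‖ₑ ^ q) ≤ 1) : ∃ δ, point q T δ = f := by
  obtain ⟨c, rfl⟩ := exists_cubePoint_eq (f := f) fun k => by
    have h := (le_rhoSum T (fun k => ‖f k‖ₑ ^ q) k).trans hf
    rw [← ENNReal.one_rpow q, ENNReal.rpow_le_rpow_iff hq, ← ofReal_norm,
      ENNReal.ofReal_le_one] at h
    exact h
  exact ⟨c, congrArg cubePoint (retr_eq_self hf)⟩

lemma codes_nonempty {q : ℝ} (hq : 0 < q) (T : Finset ℕ → Bool) : (codes q T).Nonempty := by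
  obtain ⟨c, hc⟩ := exists_cubePoint_eq (f := 0) (by simp)
  refine ⟨c, ?_⟩
  have : (fun k => ‖cubePoint c k‖ₑ ^ q) = (0 : ℕ → ENNReal) := by
    funext k
    simp [hc, hq]
  simp [codes, this, rhoSum_zero]

lemma rhoSum_point_le {q : ℝ} (hq : 0 < q) (T : Finset ℕ → Bool) (δ : CantorSpace) :
    rhoSum T (fun k => ‖point q T δ k‖ₑ ^ q) ≤ 1 :=
  retr_mem (codes_nonempty hq T) (isClosed_codes_right q T) δ

/-- The subspace of `C(Δ)` attached to `T`. -/
noncomputable def treeSpace (q : ℝ) (T : Finset ℕ → Bool) : SB := closedSpan (coordFn q T)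

lemma measurable_treeSpace (q : ℝ) : Measurable (treeSpace q) :=
  measurable_closedSpan fun k δ =>
    (continuous_cubePoint k).measurable.comp (measurable_retr (isClosed_codes q) δ)

/-- Linear relations between points are inherited by the values of the functions of the space. -/
lemma apply_eq_sum_of_point_eq {q : ℝ} {T : Finset ℕ → Bool} {ι : Type*} {s : Finset ι}
    {δ : CantorSpace} {e : ι → CantorSpace} {a : ι → ℝ}
    (h : ∀ k, point q T δ k = ∑ i ∈ s, a i * point q T (e i) k) {x : CDelta}
    (hx : x ∈ (treeSpace q T).1) : x δ = ∑ i ∈ s, a i * x (e i) := by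
  have hcl : IsClosed {x : CDelta | x δ = ∑ i ∈ s, a i * x (e i)} :=
    isClosed_eq (by fun_prop) (by fun_prop)
  refine closure_minimal (fun x hx => ?_) hcl hx
  induction hx using Submodule.span_induction with
  | mem x hx =>
    obtain ⟨k, rfl⟩ := hx
    exact h k
  | zero => simp
  | add x y _ _ hx hy =>
    simp only [Set.mem_ofPred_eq, ContinuousMap.add_apply, mul_add, Finset.sum_add_distrib] at *
    rw [hx, hy]
  | smul r x _ hx =>
    simp only [Set.mem_ofPred_eq, ContinuousMap.smul_apply, smul_eq_mul] at hx ⊢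
    rw [hx, Finset.mul_sum]
    exact Finset.sum_congr rfl fun i _ => by ring

lemma apply_eq_mul_of_point_eq {q : ℝ} {T : Finset ℕ → Bool} {δ δ' : CantorSpace} {a : ℝ}
    (h : ∀ k, point q T δ k = a * point q T δ' k) {x : CDelta} (hx : x ∈ (treeSpace q T).1) :
    x δ = a * x δ' := by
  simpa using apply_eq_sum_of_point_eq (s := Finset.univ) (e := fun _ : Unit => δ')
    (a := fun _ => a) (by simpa using h) hx

lemma apply_eq_add_of_point_eq {q : ℝ} {T : Finset ℕ → Bool} {δ δ₁ δ₂ : CantorSpace}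
    (h : ∀ k, point q T δ k = point q T δ₁ k + point q T δ₂ k) {x : CDelta}
    (hx : x ∈ (treeSpace q T).1) : x δ = x δ₁ + x δ₂ := by
  simpa using apply_eq_sum_of_point_eq (s := Finset.univ) (e := ![δ₁, δ₂])
    (a := fun _ => 1) (by simpa using h) hx

lemma exists_point_eq_single {q : ℝ} (hq : 1 ≤ q) (T : Finset ℕ → Bool) (k : ℕ) :
    ∃ δ, point q T δ = Pi.single k (1 / 2) := by
  have hq0 : 0 < q := by linarith
  refine exists_point_eq hq0 ((rhoSum_le_two_mul_tsum T _).trans ?_)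
  rw [tsum_eq_single k fun j hj => by simp [Pi.single_eq_of_ne hj, hq0]]
  have h2 : ‖(1 / 2 : ℝ)‖ₑ = 2⁻¹ := by
    rw [← ofReal_norm, one_div, norm_inv, Real.norm_ofNat, ENNReal.ofReal_inv_of_pos two_pos]
    simp
  rw [Pi.single_eq_same, h2]
  calc 2 * (2⁻¹ : ENNReal) ^ q ≤ 2 * (2⁻¹ : ENNReal) ^ (1 : ℝ) := by
        gcongr 2 * ?_
        exact ENNReal.rpow_le_rpow_of_exponent_ge (by simp) hq
    _ = 1 := by rw [ENNReal.rpow_one]; exact ENNReal.mul_inv_cancel (by simp) (by simp)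

/-! ### Trees with a branch -/

/-- The weight of the blocks of a point. -/
noncomputable def pointWeight (q : ℝ) (T : Finset ℕ → Bool) (z : ℕ → ℕ) (δ : CantorSpace) :
    ENNReal :=
  blockSum T (seqBlock z) fun k => ‖point q T δ k‖ₑ ^ q

/-- The norm attached to a branch `z`. -/
noncomputable def branchNorm (q : ℝ) (T : Finset ℕ → Bool) (z : ℕ → ℕ) (x : CDelta) : ℝ :=
  ⨆ δ : {δ // pointWeight q T z δ ≤ 1}, |x δ.1|

section branch

variable {q : ℝ} {z : ℕ → ℕ} {x y : CDelta}

lemma abs_apply_le_branchNorm {δ : CantorSpace} (hδ : pointWeight q T z δ ≤ 1) (x : CDelta) :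
    |x δ| ≤ branchNorm q T z x :=
  le_ciSup (f := fun δ : {δ // pointWeight q T z δ ≤ 1} => |x δ.1|)
    ⟨‖x‖, by rintro _ ⟨δ, rfl⟩; exact x.norm_coe_le_norm δ.1⟩ ⟨δ, hδ⟩

lemma branchNorm_nonneg : 0 ≤ branchNorm q T z x := Real.iSup_nonneg fun _ => abs_nonneg _

lemma branchNorm_le {r : ℝ} (hr : 0 ≤ r) (h : ∀ δ, pointWeight q T z δ ≤ 1 → |x δ| ≤ r) :
    branchNorm q T z x ≤ r := Real.iSup_le (fun δ => h δ.1 δ.2) hr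

lemma branchNorm_le_norm : branchNorm q T z x ≤ ‖x‖ :=
  branchNorm_le (norm_nonneg _) fun δ _ => x.norm_coe_le_norm δ

lemma branchNorm_add_le : branchNorm q T z (x + y) ≤ branchNorm q T z x + branchNorm q T z y :=
  branchNorm_le (add_nonneg branchNorm_nonneg branchNorm_nonneg) fun _ hδ =>
    (abs_add_le _ _).trans
      (add_le_add (abs_apply_le_branchNorm hδ x) (abs_apply_le_branchNorm hδ y))

lemma branchNorm_smul (a : ℝ) : branchNorm q T z (a • x) = |a| * branchNorm q T z x := by
  rw [branchNorm, branchNorm, Real.mul_iSup_of_nonneg (abs_nonneg a)]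
  simp [abs_mul]

lemma abs_apply_le_mul_of_pos (hq : 0 < q) (hx : x ∈ (treeSpace q T).1) {δ : CantorSpace} {α : ℝ}
    (hα : 0 < α) (hδ : pointWeight q T z δ ≤ ENNReal.ofReal (α ^ q)) :
    |x δ| ≤ α * branchNorm q T z x := by
  have hαq : ENNReal.ofReal (α ^ q) = ENNReal.ofReal α ^ q :=
    (ENNReal.ofReal_rpow_of_pos hα).symm
  have hF : (fun k => ‖α⁻¹ * point q T δ k‖ₑ ^ q) =
      fun k => (ENNReal.ofReal α ^ q)⁻¹ * ‖point q T δ k‖ₑ ^ q := by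
    funext k
    rw [enorm_mul, ENNReal.mul_rpow_of_nonneg _ _ hq.le, Real.enorm_of_nonneg (by positivity),
      ENNReal.ofReal_inv_of_pos hα, ENNReal.inv_rpow]
  have hle : blockSum T (seqBlock z) (fun k => ‖α⁻¹ * point q T δ k‖ₑ ^ q) ≤ 1 := by
    rw [hF, blockSum_const_mul, ← hαq]
    calc _ ≤ (ENNReal.ofReal (α ^ q))⁻¹ * ENNReal.ofReal (α ^ q) := by gcongr; exact hδ
      _ ≤ 1 := ENNReal.inv_mul_le_one _
  obtain ⟨δ', hδ'⟩ := exists_point_eq hq ((rhoSum_le_blockSum T (seqBlock z) _).trans hle)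
  have hx' : x δ = α * x δ' := apply_eq_mul_of_point_eq (fun k => by
    rw [hδ', mul_inv_cancel_left₀ hα.ne']) hx
  rw [hx', abs_mul, abs_of_pos hα]
  gcongr
  refine abs_apply_le_branchNorm ?_ x
  rwa [pointWeight, hδ']

lemma abs_apply_le_mul (hq : 0 < q) (hx : x ∈ (treeSpace q T).1) {δ : CantorSpace} {α : ℝ}
    (hα : 0 ≤ α) (hδ : pointWeight q T z δ ≤ ENNReal.ofReal (α ^ q)) :
    |x δ| ≤ α * branchNorm q T z x := by
  refine le_of_forall_pos_le_add fun ε hε => ?_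
  have hN : 0 < branchNorm q T z x + 1 := by
    linarith [branchNorm_nonneg (q := q) (T := T) (z := z) (x := x)]
  have h := abs_apply_le_mul_of_pos hq hx (α := α + ε / (branchNorm q T z x + 1)) (by positivity)
    (hδ.trans (by gcongr; linarith [div_pos hε hN]))
  refine h.trans ?_
  rw [add_mul, div_mul_eq_mul_div]
  gcongr
  rw [div_le_iff₀ hN]
  nlinarith

lemma norm_le_two_mul_branchNorm (hq : 1 ≤ q) (hz : StrictMono z)
    (hT : ∀ n, T ((Finset.range (n + 1)).image z) = true) (hx : x ∈ (treeSpace q T).1) :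
    ‖x‖ ≤ 2 * branchNorm q T z x := by
  have hq0 : 0 < q := by linarith
  refine (ContinuousMap.norm_le _ (mul_nonneg zero_le_two branchNorm_nonneg)).2 fun δ => ?_
  refine abs_apply_le_mul hq0 hx zero_le_two ((blockSum_le_two_mul hz hT _).trans ?_)
  calc 2 * rhoSum T (fun k => ‖point q T δ k‖ₑ ^ q) ≤ 2 * 1 := by
        gcongr; exact rhoSum_point_le hq0 T δ
    _ = ENNReal.ofReal (2 ^ (1 : ℝ)) := by simp
    _ ≤ _ := ENNReal.ofReal_le_ofReal (Real.rpow_le_rpow_of_exponent_le one_le_two hq)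

lemma isEquivNorm_branchNorm (hq : 1 ≤ q) (hz : StrictMono z)
    (hT : ∀ n, T ((Finset.range (n + 1)).image z) = true) :
    IsEquivNorm (treeSpace q T).1 fun x => branchNorm q T z x.1 := by
  have h2 : ∀ x : (treeSpace q T).1, ‖x‖ ≤ 2 * branchNorm q T z x.1 := fun x =>
    norm_le_two_mul_branchNorm hq hz hT x.2
  refine ⟨⟨fun _ => branchNorm_nonneg, fun x => ⟨fun h => ?_, ?_⟩,
    fun a x => branchNorm_smul a, fun x y => branchNorm_add_le⟩, 1 / 2, by norm_num, 1, one_pos,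
    fun x => ⟨by linarith [h2 x], by rw [one_mul]; exact branchNorm_le_norm⟩⟩
  · have := h2 x
    rw [show branchNorm q T z x.1 = 0 from h, mul_zero] at this
    exact norm_le_zero_iff.1 this
  · rintro rfl
    simp [branchNorm]

/-- Young's inequality for a decomposition into two pieces. -/
lemma add_mul_le_one_add {p q α β τ : ℝ} (hpq : p.HolderConjugate q) (hα : 0 ≤ α) (hβ : 0 ≤ β)
    (hτ : 0 ≤ τ) (h : α ^ q + β ^ q ≤ 1) : α + τ * β ≤ 1 + τ ^ p / p := by
  have h1 := Real.young_inequality_of_nonneg zero_le_one hα hpq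
  have h2 := Real.young_inequality_of_nonneg hτ hβ hpq
  rw [Real.one_rpow, one_mul] at h1
  have h3 : α ^ q / q + β ^ q / q ≤ 1 / q := by
    rw [← add_div]
    exact div_le_div_of_nonneg_right h hpq.symm.pos.le
  have h4 : 1 / p + 1 / q = 1 := by simpa using hpq.inv_add_inv_eq_one
  linarith

/-- Splitting a point at an element of the branch. -/
lemma exists_split (hq : 0 < q) (hz : StrictMono z) (m : ℕ) {δ : CantorSpace}
    (hδ : pointWeight q T z δ ≤ 1) : ∃ (δ₁ δ₂ : CantorSpace) (α β : ℝ), 0 ≤ α ∧ 0 ≤ β ∧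
      α ^ q + β ^ q ≤ 1 ∧ pointWeight q T z δ₁ ≤ ENNReal.ofReal (α ^ q) ∧
      pointWeight q T z δ₂ ≤ ENNReal.ofReal (β ^ q) ∧
      (∀ k, point q T δ k = point q T δ₁ k + point q T δ₂ k) ∧
      (∀ k, z m ≤ k → point q T δ₁ k = 0) ∧ ∀ k < z m, point q T δ₂ k = 0 := by
  let f₁ : ℕ → ℝ := fun k => if k < z m then point q T δ k else 0
  let f₂ : ℕ → ℝ := fun k => if k < z m then 0 else point q T δ k
  have h1 : (fun k => ‖f₁ k‖ₑ ^ q) = fun k => if k < z m then ‖point q T δ k‖ₑ ^ q else 0 := by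
    funext k; simp only [f₁]; split_ifs <;> simp [hq]
  have h2 : (fun k => ‖f₂ k‖ₑ ^ q) = fun k => if k < z m then 0 else ‖point q T δ k‖ₑ ^ q := by
    funext k; simp only [f₂]; split_ifs <;> simp [hq]
  have hcut := blockSum_cut (T := T) hz m fun k => ‖point q T δ k‖ₑ ^ q
  rw [← h1, ← h2] at hcut
  set A := blockSum T (seqBlock z) fun k => ‖f₁ k‖ₑ ^ q with hA
  set B := blockSum T (seqBlock z) fun k => ‖f₂ k‖ₑ ^ q with hB
  have hAB : A + B ≤ 1 := hcut.trans_le hδ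
  have hA1 : A ≤ 1 := le_self_add.trans hAB
  have hB1 : B ≤ 1 := le_add_self.trans hAB
  have hA' : A ≠ ⊤ := (hA1.trans_lt ENNReal.one_lt_top).ne
  have hB' : B ≠ ⊤ := (hB1.trans_lt ENNReal.one_lt_top).ne
  obtain ⟨δ₁, hδ₁⟩ := exists_point_eq hq ((rhoSum_le_blockSum T (seqBlock z) _).trans hA1)
  obtain ⟨δ₂, hδ₂⟩ := exists_point_eq hq ((rhoSum_le_blockSum T (seqBlock z) _).trans hB1)
  have hpow : ∀ {C : ENNReal}, (C.toReal ^ q⁻¹) ^ q = C.toReal := fun {C} =>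
    Real.rpow_inv_rpow ENNReal.toReal_nonneg hq.ne'
  refine ⟨δ₁, δ₂, A.toReal ^ q⁻¹, B.toReal ^ q⁻¹, by positivity, by positivity, ?_, ?_, ?_,
    fun k => ?_, fun k hk => ?_, fun k hk => ?_⟩
  · rw [hpow, hpow, ← ENNReal.toReal_add hA' hB']
    exact ENNReal.toReal_le_of_le_ofReal zero_le_one (by simpa using hAB)
  · rw [hpow, ENNReal.ofReal_toReal hA', pointWeight, hδ₁]
  · rw [hpow, ENNReal.ofReal_toReal hB', pointWeight, hδ₂]
  · rw [hδ₁, hδ₂]; simp only [f₁, f₂]; split_ifs <;> simp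
  · rw [hδ₁]; simp only [f₁, if_neg hk.not_gt]
  · rw [hδ₂]; simp only [f₂, if_pos hk]

/-- Elements of the space are approximated by elements depending on finitely many coordinates. -/
lemma exists_norm_sub_lt (hx : x ∈ (treeSpace q T).1) {η : ℝ} (hη : 0 < η) :
    ∃ y ∈ (treeSpace q T).1, ‖x - y‖ < η ∧
      ∃ M, ∀ δ, (∀ k < M, point q T δ k = 0) → y δ = 0 := by
  obtain ⟨y, hy, hxy⟩ := Metric.mem_closure_iff.1 (show x ∈ closure _ from hx) η hη
  refine ⟨y, Submodule.le_topologicalClosure _ hy, by rwa [← dist_eq_norm], ?_⟩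
  obtain ⟨c, rfl⟩ := (Finsupp.mem_span_range_iff_exists_finsupp).1 hy
  refine ⟨c.support.sup id + 1, fun δ h => ?_⟩
  rw [Finsupp.sum, ContinuousMap.sum_apply]
  refine Finset.sum_eq_zero fun k hk => ?_
  have : k ≤ c.support.sup id := Finset.le_sup (f := id) hk
  simp [h k (by omega)]

/-- The elements of the space vanishing at the points given by the first `M` unit vectors. -/
lemma exists_finite_codim (hq : 1 ≤ q) (T : Finset ℕ → Bool) (M : ℕ) :
    ∃ E : Submodule ℝ (treeSpace q T).1, IsClosed (E : Set (treeSpace q T).1) ∧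
      FiniteDimensional ℝ ((treeSpace q T).1 ⧸ E) ∧
      ∀ x ∈ E, ∀ δ, (∀ k, M ≤ k → point q T δ k = 0) → x.1 δ = 0 := by
  choose e he using exists_point_eq_single hq T
  let L : (treeSpace q T).1 →ₗ[ℝ] (Fin M → ℝ) :=
    { toFun := fun x k => x.1 (e k)
      map_add' := fun x y => rfl
      map_smul' := fun a x => rfl }
  have hL : Continuous L := continuous_pi fun k =>
    (continuous_eval_const (e k)).comp continuous_subtype_val
  refine ⟨LinearMap.ker L, (isClosed_singleton (x := (0 : Fin M → ℝ))).preimage hL,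
    L.quotKerEquivRange.symm.finiteDimensional, fun x hx δ hδ => ?_⟩
  rw [apply_eq_sum_of_point_eq (s := Finset.range M) (e := e) (a := fun i => 2 * point q T δ i)
    (fun k => ?_) x.2]
  · refine Finset.sum_eq_zero fun i hi => ?_
    have : L x ⟨i, Finset.mem_range.1 hi⟩ = 0 := by rw [LinearMap.mem_ker.1 hx]; rfl
    rw [show x.1 (e i) = 0 from this, mul_zero]
  · by_cases hk : k < M
    · rw [Finset.sum_eq_single_of_mem k (Finset.mem_range.2 hk)]
      · rw [he, Pi.single_eq_same]; ring
      · intro i _ hik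
        rw [he, Pi.single_eq_of_ne hik.symm, mul_zero]
    · rw [hδ k (not_lt.1 hk)]
      refine (Finset.sum_eq_zero fun i hi => ?_).symm
      have hi := Finset.mem_range.1 hi
      rw [he, Pi.single_eq_of_ne (by omega), mul_zero]

lemma branchNorm_add_smul_le {p : ℝ} (hpq : p.HolderConjugate q) (hz : StrictMono z)
    (hy : y ∈ (treeSpace q T).1) (hy1 : branchNorm q T z y ≤ 1) {η : ℝ} (hη : 0 < η) :
    ∃ E : Submodule ℝ (treeSpace q T).1, IsClosed (E : Set (treeSpace q T).1) ∧
      FiniteDimensional ℝ ((treeSpace q T).1 ⧸ E) ∧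
      ∀ x ∈ E, branchNorm q T z x.1 ≤ 1 → ∀ τ, 0 ≤ τ →
        branchNorm q T z (y + τ • x.1) ≤ 1 + τ ^ p / p + 2 * η := by
  have hq : 1 < q := hpq.symm.lt
  have hp : 0 < p := hpq.pos
  obtain ⟨y', hy', hyy', M, hM⟩ := exists_norm_sub_lt hy hη
  obtain ⟨E, hE, hEfin, h0⟩ := exists_finite_codim hq.le T (z M)
  refine ⟨E, hE, hEfin, fun x hxE hx1 τ hτ => branchNorm_le (by positivity) fun δ hδ => ?_⟩
  obtain ⟨δ₁, δ₂, α, β, hα, hβ, hαβ, hδ₁, hδ₂, hadd, hsupp₁, hsupp₂⟩ :=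
    exists_split (by linarith) hz M hδ
  have hN : branchNorm q T z y' ≤ 1 + η := by
    calc branchNorm q T z y' = branchNorm q T z (y + (-1 : ℝ) • (y - y')) := by
          congr 1; module
      _ ≤ branchNorm q T z y + |-1| * branchNorm q T z (y - y') := by
          rw [← branchNorm_smul]; exact branchNorm_add_le
      _ ≤ 1 + η := by
          rw [abs_neg, abs_one, one_mul]
          exact add_le_add hy1 (branchNorm_le_norm.trans hyy'.le)
  have hα1 : α ≤ 1 := by
    by_contra! hc
    have := Real.one_lt_rpow hc (by linarith : 0 < q)
    have := Real.rpow_nonneg hβ q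
    linarith
  have e1 : y' δ = y' δ₁ := by
    rw [apply_eq_add_of_point_eq hadd hy', hM δ₂ fun k hk => hsupp₂ k (hk.trans_le (hz.le_apply)),
      add_zero]
  have e2 : x.1 δ = x.1 δ₂ := by
    rw [apply_eq_add_of_point_eq hadd x.2, h0 x hxE δ₁ hsupp₁, zero_add]
  have b1 : |y' δ| ≤ α + η := by
    rw [e1]
    calc _ ≤ α * branchNorm q T z y' := abs_apply_le_mul (by linarith) hy' hα hδ₁
      _ ≤ α * (1 + η) := by gcongr
      _ ≤ α + η := by nlinarith
  have b2 : |x.1 δ| ≤ β := by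
    rw [e2]
    calc _ ≤ β * branchNorm q T z x.1 := abs_apply_le_mul (by linarith) x.2 hβ hδ₂
      _ ≤ β := mul_le_of_le_one_right hβ hx1
  have b3 : |(y - y') δ| ≤ η := ((y - y').norm_coe_le_norm δ).trans hyy'.le
  have hyoung := add_mul_le_one_add hpq hα hβ hτ hαβ
  have hval : (y + τ • x.1) δ = (y - y') δ + (y' δ + τ * x.1 δ) := by
    simp only [ContinuousMap.add_apply, ContinuousMap.smul_apply, ContinuousMap.sub_apply,
      smul_eq_mul]
    ring
  calc |(y + τ • x.1) δ| ≤ |(y - y') δ| + (|y' δ| + |τ * x.1 δ|) := by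
        rw [hval]
        exact (abs_add_le _ _).trans (add_le_add_right (abs_add_le _ _) _)
    _ ≤ η + (α + η + τ * β) := by rw [abs_mul, abs_of_nonneg hτ]; gcongr
    _ ≤ _ := by linarith

end branch

theorem pAUSable_of_hasBranch {p q : ℝ} (hpq : p.HolderConjugate q) (hT : HasBranch T) :
    PAUSable p (treeSpace q T).1 := by
  obtain ⟨z, hz, hT⟩ := hT
  have hp : 0 < p := hpq.pos
  refine ⟨_, isEquivNorm_branchNorm hpq.symm.lt.le hz hT, 1 / p, by positivity, fun τ hτ => ?_⟩
  have hnn : 0 ≤ 1 / p * τ ^ p := by positivity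
  rw [rhoN]
  split_ifs
  · exact hnn
  refine Real.sSup_le ?_ hnn
  rintro _ ⟨y, hy, rfl⟩
  by_cases hb : BddBelow { s : ℝ | ∃ E : Submodule ℝ (treeSpace q T).1,
      IsClosed (E : Set (treeSpace q T).1) ∧ FiniteDimensional ℝ ((treeSpace q T).1 ⧸ E) ∧
        s = sSup { t : ℝ | ∃ x ∈ E, branchNorm q T z x.1 ≤ 1 ∧
          t = branchNorm q T z (y + τ • x).1 - 1 } }
  · refine le_of_forall_pos_le_add fun η hη => ?_
    obtain ⟨E, hE, hEfin, h⟩ := branchNorm_add_smul_le hpq hz y.2 hy (half_pos hη)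
    refine (csInf_le hb ⟨E, hE, hEfin, rfl⟩).trans (Real.sSup_le ?_ (by positivity))
    rintro _ ⟨x, hx, hx1, rfl⟩
    have := h x hx hx1 τ hτ
    have e : τ ^ p / p = 1 / p * τ ^ p := by ring
    exact (by linarith : branchNorm q T z (y.1 + τ • x.1) - 1 ≤ 1 / p * τ ^ p + η)
  · rw [Real.sInf_of_not_bddBelow hb]
    exact hnn

/-! ### Upper estimates along subsequences -/

section upper

variable {X : Type*} [NormedAddCommGroup X] [NormedSpace ℝ X] {N : X → ℝ} {p C B : ℝ}

lemma continuous_of_isEquivNorm (hN : IsEquivNorm X N) : Continuous N := by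
  obtain ⟨⟨_, _, hsmul, hadd⟩, a, _, b, hb, hab⟩ := hN
  have h : ∀ x y, N x ≤ N y + b.toNNReal * dist x y := fun x y => by
    calc N x = N (y + (x - y)) := by rw [add_sub_cancel]
      _ ≤ N y + N (x - y) := hadd _ _
      _ ≤ N y + b.toNNReal * dist x y := by
        rw [dist_eq_norm, Real.coe_toNNReal b hb.le]
        gcongr
        exact (hab _).2
  exact (LipschitzWith.of_le_add_mul _ h).continuous

lemma exists_finite_codim_of_rhoN_le (hX : ¬ FiniteDimensional ℝ X) (hN : IsNormFn X N) {τ r : ℝ}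
    (hτ : 0 ≤ τ) (h : rhoN X N τ < r) {y : X} (hy : N y ≤ 1) :
    ∃ E : Submodule ℝ X, IsClosed (E : Set X) ∧ E.CoFG ∧
      ∀ x ∈ E, N x ≤ 1 → N (y + τ • x) ≤ 1 + r := by
  obtain ⟨hnn, hzero, hsmul, hadd⟩ := hN
  have hupper : ∀ y x, N y ≤ 1 → N x ≤ 1 → N (y + τ • x) - 1 ≤ τ := by
    intro y x hy hx
    have := hadd y (τ • x)
    rw [hsmul, abs_of_nonneg hτ] at this
    nlinarith
  have hbddt : ∀ y, N y ≤ 1 → ∀ E : Submodule ℝ X,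
      BddAbove { t : ℝ | ∃ x ∈ E, N x ≤ 1 ∧ t = N (y + τ • x) - 1 } := by
    rintro y hy E
    exact ⟨τ, by rintro _ ⟨x, _, hx, rfl⟩; exact hupper y x hy hx⟩
  let S : X → Set ℝ := fun y => { s : ℝ | ∃ E : Submodule ℝ X, IsClosed (E : Set X) ∧
      FiniteDimensional ℝ (X ⧸ E) ∧
        s = sSup { t : ℝ | ∃ x ∈ E, N x ≤ 1 ∧ t = N (y + τ • x) - 1 } }
  have hbdds : ∀ y, N y ≤ 1 → BddBelow (S y) := by
    refine fun y hy => ⟨-1, ?_⟩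
    rintro _ ⟨E, _, _, rfl⟩
    refine le_trans ?_ (le_csSup (hbddt y hy E) ⟨0, E.zero_mem, ?_, rfl⟩)
    · linarith [hnn (y + τ • 0)]
    · rw [(hzero 0).2 rfl]; exact zero_le_one
  have htop : IsClosed ((⊤ : Submodule ℝ X) : Set X) := isClosed_univ
  rw [rhoN, if_neg hX] at h
  have hbdd : BddAbove { r : ℝ | ∃ y : X, N y ≤ 1 ∧ r = sInf (S y) } := by
    refine ⟨τ, ?_⟩
    rintro _ ⟨y, hy, rfl⟩
    refine (csInf_le (hbdds y hy) ⟨⊤, htop, Submodule.CoFG.top, rfl⟩).trans (Real.sSup_le ?_ hτ)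
    rintro _ ⟨x, _, hx, rfl⟩
    exact hupper y x hy hx
  have hlt : sInf (S y) < r := lt_of_le_of_lt (le_csSup hbdd ⟨y, hy, rfl⟩) h
  have hne : (S y).Nonempty := ⟨_, ⊤, htop, Submodule.CoFG.top, rfl⟩
  obtain ⟨_, ⟨E, hE, hfin, rfl⟩, hs⟩ := exists_lt_of_csInf_lt hne hlt
  refine ⟨E, hE, hfin, fun x hx hx1 => ?_⟩
  linarith [le_csSup (hbddt y hy E) ⟨x, hx, hx1, rfl⟩]

/-- A one-step upper `p`-estimate for the function `N`, on large subspaces. -/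
def UpperEstimate (N : X → ℝ) (p C : ℝ) : Prop :=
  ∀ y : X, ∀ t : ℝ, 0 ≤ t → ∀ η > 0, ∃ E : Submodule ℝ X, IsClosed (E : Set X) ∧ E.CoFG ∧
    ∀ x ∈ E, N x ≤ 1 → N (y + t • x) ≤ max 1 (N y) * (1 + C * t ^ p) + η

lemma upperEstimate_of_rhoN_le (hp : 1 < p) (hX : ¬ FiniteDimensional ℝ X) (hN : IsNormFn X N)
    (hC : 0 < C) (h : ∀ τ : ℝ, 0 ≤ τ → rhoN X N τ ≤ C * τ ^ p) : UpperEstimate N p C := by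
  intro y t ht η hη
  set M := max 1 (N y) with hM
  have hM1 : 1 ≤ M := le_max_left _ _
  have hM0 : 0 < M := by linarith
  have hNM : ∀ x, N x = M * N (M⁻¹ • x) := fun x => by
    rw [hN.2.2.1, abs_of_pos (inv_pos.2 hM0), mul_inv_cancel_left₀ hM0.ne']
  have hy : N (M⁻¹ • y) ≤ 1 := by
    have : N y ≤ M := le_max_right _ _
    rw [hNM y] at this
    nlinarith
  obtain ⟨E, hE, hfin, hx⟩ := exists_finite_codim_of_rhoN_le hX hN (div_nonneg ht hM0.le)
    ((h (t / M) (div_nonneg ht hM0.le)).trans_lt (lt_add_of_pos_right _ (div_pos hη hM0))) hy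
  refine ⟨E, hE, hfin, fun x hxE hx1 => ?_⟩
  have h1 : (t / M) ^ p ≤ t ^ p :=
    Real.rpow_le_rpow (div_nonneg ht hM0.le) (div_le_self ht hM1) (by linarith)
  calc N (y + t • x) = M * N (M⁻¹ • y + (t / M) • x) := by
        rw [hNM, smul_add, smul_smul, div_eq_inv_mul]
    _ ≤ M * (1 + (C * (t / M) ^ p + η / M)) := by gcongr; exact hx x hxE hx1
    _ ≤ M * (1 + (C * t ^ p + η / M)) := by gcongr
    _ = _ := by rw [← add_assoc, mul_add _ _ (η / M), mul_div_cancel₀ _ hM0.ne']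

lemma UpperEstimate.compact (h : UpperEstimate N p C) (hp : 1 < p) (hN : IsEquivNorm X N)
    {K : Set (X × ℝ)} (hK : IsCompact K) (hK0 : ∀ r ∈ K, 0 ≤ r.2) {η : ℝ} (hη : 0 < η) :
    ∃ E : Submodule ℝ X, IsClosed (E : Set X) ∧ E.CoFG ∧ ∀ r ∈ K, ∀ x ∈ E, N x ≤ 1 →
      N (r.1 + r.2 • x) ≤ max 1 (N r.1) * (1 + C * r.2 ^ p) + η := by
  have hcont := continuous_of_isEquivNorm hN
  obtain ⟨⟨hnn, hzero, hsmul, hadd⟩, -⟩ := hN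
  refine hK.induction_on (p := fun K => ∃ E : Submodule ℝ X, IsClosed (E : Set X) ∧ E.CoFG ∧
    ∀ r ∈ K, ∀ x ∈ E, N x ≤ 1 → N (r.1 + r.2 • x) ≤ max 1 (N r.1) * (1 + C * r.2 ^ p) + η)
    ⟨⊤, isClosed_univ, Submodule.CoFG.top, by simp⟩ ?_ ?_ ?_
  · rintro s t hst ⟨E, hE, hfin, h⟩
    exact ⟨E, hE, hfin, fun r hr => h r (hst hr)⟩
  · rintro s t ⟨E, hE, hfin, h⟩ ⟨E', hE', hfin', h'⟩
    refine ⟨E ⊓ E', hE.inter hE', hfin.inf hfin', ?_⟩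
    rintro r (hr | hr) x hx
    exacts [h r hr x hx.1, h' r hr x hx.2]
  · intro r₀ hr₀
    obtain ⟨E, hE, hfin, h⟩ := h r₀.1 r₀.2 (hK0 r₀ hr₀) (η / 2) (half_pos hη)
    let g : X × ℝ → ℝ := fun r => max 1 (N r.1) * (1 + C * r.2 ^ p)
    have hg : Continuous g := by
      have : Continuous fun t : ℝ => t ^ p := Real.continuous_rpow_const (by linarith)
      fun_prop
    let d : X × ℝ → ℝ := fun r => g r₀ - g r + N (r.1 - r₀.1) + |r.2 - r₀.2|
    have hd : Continuous d := by fun_prop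
    have hd0 : d r₀ = 0 := by simp [d, (hzero 0).2 rfl]
    have hev : ∀ᶠ r in 𝓝 r₀, d r < η / 2 :=
      hd.continuousAt.eventually_lt continuousAt_const (by rw [hd0]; exact half_pos hη)
    refine ⟨_, mem_nhdsWithin_of_mem_nhds hev, E, hE, hfin, fun r hr x hx hx1 => ?_⟩
    have hr : g r₀ - g r + N (r.1 - r₀.1) + |r.2 - r₀.2| < η / 2 := hr
    have h1 := h x hx hx1
    have h2 : N (r.1 + r.2 • x) ≤ N (r₀.1 + r₀.2 • x) + (N (r.1 - r₀.1) + |r.2 - r₀.2|) := by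
      calc N (r.1 + r.2 • x) =
            N ((r₀.1 + r₀.2 • x) + ((r.1 - r₀.1) + (r.2 - r₀.2) • x)) := by congr 1; module
        _ ≤ N (r₀.1 + r₀.2 • x) + (N (r.1 - r₀.1) + |r.2 - r₀.2| * N x) := by
            rw [← hsmul]
            exact (hadd _ _).trans (by gcongr; exact hadd _ _)
        _ ≤ _ := by gcongr; exact mul_le_of_le_one_right (abs_nonneg _) hx1
    change N (r.1 + r.2 • x) ≤ g r + η
    change N (r₀.1 + r₀.2 • x) ≤ g r₀ + η / 2 at h1
    linarith

/-- Differences of members of a bounded sequence come close to any subspace of finite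
codimension. -/
lemma exists_sub_near {E : Submodule ℝ X} (hE : IsClosed (E : Set X)) (hfin : E.CoFG) {e : ℕ → X}
    (he : ∀ k, ‖e k‖ ≤ 1) (K : ℕ) {ε : ℝ} (hε : 0 < ε) :
    ∃ k k', K ≤ k ∧ k < k' ∧ ∃ u ∈ E, ‖e k - e k' - u‖ < ε := by
  have : ProperSpace (X ⧸ E) := FiniteDimensional.proper ℝ _
  obtain ⟨a, _, φ, hφ, hlim⟩ := tendsto_subseq_of_bounded (x := fun k => E.mkQ (e k))
    (isBounded_closedBall (x := (0 : X ⧸ E)) (r := 1)) fun k => by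
      rw [mem_closedBall, dist_zero_right]
      exact (Submodule.Quotient.norm_mk_le E (e k)).trans (he k)
  obtain ⟨M, hM⟩ := Metric.cauchySeq_iff.1 hlim.cauchySeq ε hε
  have hd := hM (max M K) (le_max_left _ _) (max M K + 1) (by omega)
  refine ⟨φ (max M K), φ (max M K + 1), (le_max_right _ _).trans hφ.le_apply,
    hφ (Nat.lt_succ_self _), ?_⟩
  set k := φ (max M K)
  set k' := φ (max M K + 1)
  have hd : ‖E.mkQ (e k - e k')‖ < ε := by rwa [map_sub, ← dist_eq_norm]
  obtain ⟨v, hv, hvn⟩ := Submodule.Quotient.norm_mk_lt (E.mkQ (e k - e k')) (sub_pos.2 hd)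
  refine ⟨e k - e k' - v, ?_, ?_⟩
  · rw [← Submodule.Quotient.mk_eq_zero, Submodule.Quotient.mk_sub, hv]
    exact sub_self _
  · rw [sub_sub_cancel]
    linarith

lemma UpperEstimate.exists_sub (h : UpperEstimate N p C) (hp : 1 < p) (hC : 0 < C)
    (hN : IsEquivNorm X N) {e : ℕ → X} (he : ∀ k, ‖e k‖ ≤ 1) :
    ∃ C' > 0, ∀ (Y : Set X) (K : ℕ), IsCompact Y → ∀ η > 0, ∃ k k', K ≤ k ∧ k < k' ∧
      ∀ y ∈ Y, ∀ t ∈ Set.Icc (0 : ℝ) 1,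
        N (y + t • (e k - e k')) ≤ max 1 (N y) * (1 + C' * t ^ p) + η := by
  obtain ⟨hnorm, a, ha, b, hb, hab⟩ := id hN
  obtain ⟨hnn, hzero, hsmul, hadd⟩ := hnorm
  let B := 3 * b
  have hB : 0 < B := by positivity
  refine ⟨C * B ^ p, by positivity, fun Y K hY η hη => ?_⟩
  obtain ⟨E, hE, hfin, hest⟩ := h.compact hp hN (hY.prod (isCompact_Icc (a := (0 : ℝ)) (b := B)))
    (fun r hr => hr.2.1) (half_pos hη)
  have hε : 0 < min 1 (η / 2 / b) := lt_min one_pos (by positivity)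
  obtain ⟨k, k', hk, hkk', u, hu, hd⟩ := exists_sub_near hE hfin he K hε
  refine ⟨k, k', hk, hkk', fun y hy t ht => ?_⟩
  have hv : N (e k - e k' - u) ≤ η / 2 := by
    calc _ ≤ b * ‖e k - e k' - u‖ := (hab _).2
      _ ≤ b * (η / 2 / b) := by gcongr; exact hd.le.trans (min_le_right _ _)
      _ = η / 2 := mul_div_cancel₀ _ hb.ne'
  have hu3 : N (B⁻¹ • u) ≤ 1 := by
    have h3 : ‖u‖ ≤ 3 := by
      calc ‖u‖ = ‖e k - e k' - (e k - e k' - u)‖ := by rw [sub_sub_cancel]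
        _ ≤ ‖e k‖ + ‖e k'‖ + ‖e k - e k' - u‖ :=
            (norm_sub_le _ _).trans (add_le_add_left (norm_sub_le _ _) _)
        _ ≤ 1 + 1 + 1 := add_le_add (add_le_add (he k) (he k')) (hd.le.trans (min_le_left _ _))
        _ = 3 := by norm_num
    rw [hsmul, abs_of_pos (inv_pos.2 hB), inv_mul_le_iff₀ hB, mul_one]
    calc N u ≤ b * ‖u‖ := (hab u).2
      _ ≤ b * 3 := by gcongr
      _ = B := mul_comm _ _
  have hBt : B * t ∈ Set.Icc 0 B := ⟨mul_nonneg hB.le ht.1, mul_le_of_le_one_right hB.le ht.2⟩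
  have h1 := hest (y, B * t) ⟨hy, hBt⟩ (B⁻¹ • u) (E.smul_mem _ hu) hu3
  have h2 : (B * t) • B⁻¹ • u = t • u := by
    rw [smul_smul, mul_right_comm, mul_inv_cancel₀ hB.ne', one_mul]
  simp only [h2, Real.mul_rpow hB.le ht.1, ← mul_assoc] at h1
  calc N (y + t • (e k - e k')) = N ((y + t • u) + t • (e k - e k' - u)) := by congr 1; module
    _ ≤ N (y + t • u) + |t| * N (e k - e k' - u) := by rw [← hsmul]; exact hadd _ _
    _ ≤ (max 1 (N y) * (1 + C * B ^ p * t ^ p) + η / 2) + 1 * (η / 2) := by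
        gcongr
        · exact hnn _
        · rw [abs_of_nonneg ht.1]
          exact ht.2
    _ = _ := by ring

/-- Upper `p`-estimates for a sequence of differences. -/
lemma exists_upper_sequence (hp : 1 < p) (hX : ¬ FiniteDimensional ℝ X) (hN : IsEquivNorm X N)
    (hA : IsPAUSNorm X N p) {e : ℕ → X} (he : ∀ k, ‖e k‖ ≤ 1) :
    ∃ (D : ℝ) (k k' : ℕ → ℕ), (∀ j, k j < k' j) ∧ (∀ j, k' j < k (j + 1)) ∧
      ∀ a : ℕ → ℝ, (∀ j, a j ∈ Set.Icc (0 : ℝ) 1) → ∀ m, ∑ j ∈ Finset.range m, a j ^ p ≤ 1 →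
        N (∑ j ∈ Finset.range m, a j • (e (k j) - e (k' j))) ≤ D := by
  obtain ⟨C, hC, hrho⟩ := hA
  obtain ⟨C', hC', hstep⟩ :=
    (upperEstimate_of_rhoN_le hp hX hN.1 hC hrho).exists_sub hp hC hN he
  choose f f' hKf hff' hest using fun (n : ℕ) (s : {Y : Set X // IsCompact Y} × ℕ) =>
    hstep s.1.1 s.2 s.1.2 ((1 / 2) ^ (n + 1)) (by positivity)
  let next : ℕ → {Y : Set X // IsCompact Y} × ℕ → {Y : Set X // IsCompact Y} × ℕ := fun n s =>
    ⟨⟨(fun r : X × ℝ => r.1 + r.2 • (e (f n s) - e (f' n s))) '' (s.1.1 ×ˢ Set.Icc 0 1),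
      (s.1.2.prod isCompact_Icc).image (by fun_prop)⟩, f' n s + 1⟩
  let s : ℕ → {Y : Set X // IsCompact Y} × ℕ := fun n =>
    Nat.rec ⟨⟨{0}, isCompact_singleton⟩, 0⟩ next n
  have hs : ∀ n, s (n + 1) = next n (s n) := fun n => rfl
  refine ⟨Real.exp (C' + 1), fun j => f j (s j), fun j => f' j (s j), fun j => hff' j _,
    fun j => ?_, fun a ha m hm => ?_⟩
  · exact hKf (j + 1) (s (j + 1))
  · have hmem : ∀ m, ∑ j ∈ Finset.range m, a j • (e (f j (s j)) - e (f' j (s j))) ∈ (s m).1.1 := by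
      intro m
      induction m with
      | zero => rfl
      | succ m ih =>
        rw [Finset.sum_range_succ, hs]
        exact ⟨(_, a m), ⟨ih, ha m⟩, rfl⟩
    have hexp : ∀ m, max 1 (N (∑ j ∈ Finset.range m, a j • (e (f j (s j)) - e (f' j (s j))))) ≤
        Real.exp (C' * ∑ j ∈ Finset.range m, a j ^ p + (1 - (1 / 2) ^ m)) := by
      intro m
      have hexp1 : ∀ m, 1 ≤ Real.exp (C' * ∑ j ∈ Finset.range m, a j ^ p + (1 - (1 / 2) ^ m)) := by
        refine fun m => Real.one_le_exp ?_
        have h1 : ((1 : ℝ) / 2) ^ m ≤ 1 := pow_le_one₀ (by norm_num) (by norm_num)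
        have h2 : 0 ≤ ∑ j ∈ Finset.range m, a j ^ p :=
          Finset.sum_nonneg fun j _ => Real.rpow_nonneg (ha j).1 p
        have := mul_nonneg hC'.le h2
        linarith
      induction m with
      | zero => simp [(hN.1.2.1 0).2 rfl]
      | succ m ih =>
        refine max_le (hexp1 _) ?_
        have h1 := hest m (s m) _ (hmem m) (a m) (ha m)
        rw [← Finset.sum_range_succ fun j => a j • (e (f j (s j)) - e (f' j (s j)))] at h1
        refine h1.trans ?_
        set M := max 1 (N (∑ j ∈ Finset.range m, a j • (e (f j (s j)) - e (f' j (s j)))))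
        have hM : 1 ≤ M := le_max_left _ _
        have hpow : (0 : ℝ) < (1 / 2) ^ (m + 1) := by positivity
        calc M * (1 + C' * a m ^ p) + (1 / 2) ^ (m + 1)
            ≤ M * (C' * a m ^ p + (1 / 2) ^ (m + 1) + 1) := by nlinarith
          _ ≤ Real.exp (C' * ∑ j ∈ Finset.range m, a j ^ p + (1 - (1 / 2) ^ m)) *
                Real.exp (C' * a m ^ p + (1 / 2) ^ (m + 1)) := by
              have := Real.rpow_nonneg (ha m).1 p
              exact mul_le_mul ih (Real.add_one_le_exp _) (by positivity) (by positivity)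
          _ = _ := by
              rw [← Real.exp_add, Finset.sum_range_succ]
              congr 1
              ring
    refine (le_max_right _ _).trans ((hexp m).trans (Real.exp_le_exp.2 ?_))
    have h1 : (0 : ℝ) < (1 / 2) ^ m := by positivity
    nlinarith

end upper

/-! ### Trees without a branch -/

lemma coordFn_mem (q : ℝ) (T : Finset ℕ → Bool) (k : ℕ) : coordFn q T k ∈ (treeSpace q T).1 :=
  Submodule.le_topologicalClosure _ (Submodule.subset_span (Set.mem_range_self k))

lemma norm_coordFn_le (q : ℝ) (T : Finset ℕ → Bool) (k : ℕ) : ‖coordFn q T k‖ ≤ 1 := by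
  refine (ContinuousMap.norm_le _ zero_le_one).2 fun δ => ?_
  have h := (cantorToHilbert (retr (codes q T) δ) k).2
  rw [coordFn_apply, point, cubePoint, Real.norm_eq_abs, abs_le]
  constructor <;> linarith [h.1, h.2]

lemma not_finiteDimensional_treeSpace {q : ℝ} (hq : 1 ≤ q) (T : Finset ℕ → Bool) :
    ¬ FiniteDimensional ℝ (treeSpace q T).1 := by
  intro hfin
  have hli : LinearIndependent ℝ
      fun k => (⟨coordFn q T k, coordFn_mem q T k⟩ : (treeSpace q T).1) := by
    refine linearIndependent_iff'.2 fun s g hg i hi => ?_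
    obtain ⟨δ, hδ⟩ := exists_point_eq_single hq T i
    have h := congrArg (fun x : (treeSpace q T).1 => x.1 δ) hg
    simp only [Submodule.coe_sum, Submodule.coe_smul, ContinuousMap.sum_apply,
      ContinuousMap.smul_apply, coordFn_apply, hδ, smul_eq_mul, Submodule.coe_zero,
      ContinuousMap.zero_apply] at h
    rw [Finset.sum_eq_single_of_mem i hi fun j _ hj => by rw [Pi.single_eq_of_ne hj, mul_zero],
      Pi.single_eq_same] at h
    linarith
  exact not_finite_iff_infinite.2 inferInstance hli.finite_of_isNoetherian

/-- Probability vectors supported on the range of an increasing sequence. -/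
lemma isFar_range {k : ℕ → ℕ} (hk : StrictMono k) :
    IsFar {u : ℕ →₀ ℝ | (∀ i, 0 ≤ u i) ∧ Finsupp.linearCombination ℝ (fun _ => (1 : ℝ)) u = 1 ∧
      ∀ i ∉ Set.range k, u i = 0} where
  convex := by
    rintro u ⟨hu0, hu1, hu⟩ v ⟨hv0, hv1, hv⟩ a b ha hb hab
    refine ⟨fun i => ?_, ?_, fun i hi => ?_⟩
    · exact add_nonneg (mul_nonneg ha (hu0 i)) (mul_nonneg hb (hv0 i))
    · rw [map_add, map_smul, map_smul, hu1, hv1]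
      simpa using hab
    · simp [hu i hi, hv i hi]
  nonneg u hu := hu.1
  sum_eq_one u hu := by
    simpa [Finsupp.linearCombination_apply, Finsupp.sum] using hu.2.1
  exists_far n := by
    refine ⟨Finsupp.single (k n) 1, ⟨fun i => ?_, by simp, fun i hi => ?_⟩, fun i hi => ?_⟩
    · rw [Finsupp.single_apply]; split_ifs <;> norm_num
    · exact Finsupp.single_eq_of_ne fun h => hi ⟨n, h.symm⟩
    · exact Finsupp.single_eq_of_ne (hi.trans_le hk.le_apply).ne

theorem not_pAUSable_of_not_hasBranch {p q : ℝ} (hpq : p.HolderConjugate q)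
    (hT : ¬ HasBranch T) : ¬ PAUSable p (treeSpace q T).1 := by
  rintro ⟨N, hN, hA⟩
  have hp : 0 < p := hpq.pos
  have hq : 0 < q := hpq.symm.pos
  let e : ℕ → (treeSpace q T).1 := fun k => ⟨coordFn q T k, coordFn_mem q T k⟩
  obtain ⟨D, k, k', hkk', hk'k, hD⟩ := exists_upper_sequence hpq.lt
    (not_finiteDimensional_treeSpace hpq.symm.lt.le T) hN hA (e := e)
    fun i => norm_coordFn_le q T i
  obtain ⟨-, a, ha, b, hb, hab⟩ := hN
  have hk : StrictMono k := strictMono_nat_of_lt_succ fun j => (hkk' j).trans (hk'k j)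
  have hkne : ∀ j, k' j ∉ Set.range k := by
    rintro j ⟨i, hi⟩
    have h1 : j < i := hk.lt_iff_lt.1 (hi ▸ hkk' j)
    have h2 : i < j + 1 := hk.lt_iff_lt.1 (hi ▸ hk'k j)
    omega
  have hD0 : 0 ≤ D / a := by
    have h0 := hD (fun _ => 0) (fun _ => ⟨le_rfl, zero_le_one⟩) 0 (by simp)
    refine div_nonneg (le_trans ?_ h0) ha.le
    exact (mul_nonneg ha.le (norm_nonneg _)).trans (hab _).1
  let r : ℝ := D / a + 1
  have hr : 0 < r := by positivity
  have hε : 0 < (r ^ q)⁻¹ := by positivity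
  have hfar := isFar_range hk
  obtain ⟨u, hu, hsum⟩ := exists_rhoSum_le hT hfar hε
  have hu0 := hu.1
  obtain ⟨δ, hδ⟩ : ∃ δ, point q T δ = fun i => r * u i ^ q⁻¹ := by
    refine exists_point_eq hq ?_
    have : (fun i => ‖r * u i ^ q⁻¹‖ₑ ^ q) =
        fun i => ENNReal.ofReal (r ^ q) * ENNReal.ofReal (u i) := by
      funext i
      have h0 := Real.rpow_nonneg (hu0 i) q⁻¹
      rw [Real.enorm_of_nonneg (by positivity), ENNReal.ofReal_rpow_of_nonneg (by positivity) hq.le,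
        Real.mul_rpow hr.le h0, Real.rpow_inv_rpow (hu0 i) hq.ne',
        ENNReal.ofReal_mul (by positivity)]
    rw [this, rhoSum_const_mul]
    calc _ ≤ ENNReal.ofReal (r ^ q) * ENNReal.ofReal (r ^ q)⁻¹ := by gcongr
      _ = 1 := by
          rw [← ENNReal.ofReal_mul (by positivity), mul_inv_cancel₀ (by positivity),
            ENNReal.ofReal_one]
  let m := u.support.sup id + 1
  have hsum1 : ∑ j ∈ Finset.range m, u (k j) = 1 := by
    classical
    rw [← Finset.sum_image (f := fun i => u i) (g := k) fun i _ j _ h => hk.injective h,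
      ← hfar.sum_eq_one u hu]
    refine (Finset.sum_subset (fun i hi => ?_) fun i _ hi => by simpa using hi).symm
    have hi0 : u i ≠ 0 := Finsupp.mem_support_iff.1 hi
    obtain ⟨j, rfl⟩ : i ∈ Set.range k := by
      by_contra hc
      exact hi0 (hu.2.2 i hc)
    have h1 : k j ≤ u.support.sup id := Finset.le_sup (f := id) hi
    have h2 : j ≤ k j := hk.le_apply
    exact Finset.mem_image_of_mem _ (Finset.mem_range.2 (by omega))
  have hu1 : ∀ i, u i ≤ 1 := fun i => by simpa using hfar.sum_le_one hu {i}
  have hle := hD (fun j => u (k j) ^ p⁻¹)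
    (fun j => ⟨Real.rpow_nonneg (hu0 _) _, Real.rpow_le_one (hu0 _) (hu1 _) (by positivity)⟩) m
    (by simp only [Real.rpow_inv_rpow (hu0 _) hp.ne', hsum1, le_refl])
  set x := ∑ j ∈ Finset.range m, u (k j) ^ p⁻¹ • (e (k j) - e (k' j))
  have hval : x.1 δ = r := by
    simp only [x, e, Submodule.coe_sum, Submodule.coe_smul, Submodule.coe_sub,
      ContinuousMap.sum_apply, ContinuousMap.smul_apply, ContinuousMap.sub_apply, coordFn_apply,
      smul_eq_mul, hδ, hu.2.2 _ (hkne _)]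
    have hr1 : ∑ j ∈ Finset.range m, r * u (k j) = r := by rw [← Finset.mul_sum, hsum1, mul_one]
    refine Eq.trans (Finset.sum_congr rfl fun j _ => ?_) hr1
    have h1 : u (k j) ^ p⁻¹ * u (k j) ^ q⁻¹ = u (k j) := by
      rw [← Real.rpow_add_of_nonneg (hu0 _) (by positivity) (by positivity),
        hpq.inv_add_inv_eq_one, Real.rpow_one]
    rw [Real.zero_rpow (by positivity), mul_zero, sub_zero, mul_left_comm, h1]
  have hxr : r ≤ ‖x‖ := hval ▸ (le_abs_self _).trans (x.1.norm_coe_le_norm δ)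
  have hxD : ‖x‖ ≤ D / a := by
    rw [le_div_iff₀ ha, mul_comm]
    exact (hab x).1.trans hle
  have : D / a + 1 ≤ D / a := hxr.trans hxD
  linarith

end AUSComplexity

/-- For `p ∈ (1,∞)`, the class of spaces in `SB` admitting an equivalent `p`-AUS norm is not
Borel with respect to the Effros–Borel σ-algebra. -/
theorem pAUSable_class_is_not_Borel (p : ℝ) (hp : 1 < p) :
    ¬ MeasurableSet { F : SB | PAUSable p (F.1 : Submodule ℝ CDelta) } := by
  intro h
  have hpq := Real.HolderConjugate.conjExponent hp
  refine AUSComplexity.not_measurableSet_hasBranch ?_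
  convert AUSComplexity.measurable_treeSpace p.conjExponent h using 1
  ext T
  exact ⟨AUSComplexity.pAUSable_of_hasBranch hpq,
    fun h => by_contra fun hT => AUSComplexity.not_pAUSable_of_not_hasBranch hpq hT h⟩
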